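/- There exists G ≥ 1 such that for all g ≥ G: the ℚ-vector space of GL(H)-equivariant linear maps C₁₂^{(5)} → Λ⁵H has dimension 3, the space of GL(H)-equivariant linear maps C₁₂^{(5)} → Sym⁵H has dimension 3, and every GL(H)-equivariant linear map Ω̃₂^{(5)} → Λ⁵H and every GL(H)-equivariant linear map Ω̃₂^{(5)} → Sym⁵H is zero. (The multiplicities of [1⁵] and [5] in the n = 7 row of Proposition 4.1 of the paper.) -/

import Mathlib

open TensorProduct

set_option maxSynthPendingDepth 4

noncomputable section

/-- The symplectic vector space `H = ℚ^{2g}`. -/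
abbrev Hsp (g : ℕ) : Type := Fin (2 * g) → ℚ

/-- The tensor algebra `T = T(H)`. -/
abbrev TA (g : ℕ) : Type := TensorAlgebra ℚ (Hsp g)

/-- The antipode `x ↦ x̄`, determined by `overline (u₁⋯u_m) = (−1)^m u_m⋯u₁`. -/
def barT (g : ℕ) : TA g →ₗ[ℚ] TA g :=
  (MulOpposite.opLinearEquiv ℚ (M := TA g)).symm.toLinearMap ∘ₗ
    (TensorAlgebra.lift ℚ
      ((MulOpposite.opLinearEquiv ℚ (M := TA g)).toLinearMap ∘ₗ
        (-(TensorAlgebra.ι ℚ (M := Hsp g))))).toLinearMap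

/-- The coproduct `Δ : T → T ⊗ T`, the algebra homomorphism with
`Δ(u) = u ⊗ 1 + 1 ⊗ u` for `u ∈ H`. -/
def comul (g : ℕ) : TA g →ₗ[ℚ] TA g ⊗[ℚ] TA g :=
  (TensorAlgebra.lift ℚ
    (((TensorProduct.mk ℚ (TA g) (TA g)).flip 1) ∘ₗ TensorAlgebra.ι ℚ
      + (TensorProduct.mk ℚ (TA g) (TA g) 1) ∘ₗ TensorAlgebra.ι ℚ)).toLinearMap

/-- `T ⊗ T ⊗ T ⊗ T`. -/
abbrev T4 (g : ℕ) : Type := TA g ⊗[ℚ] (TA g ⊗[ℚ] (TA g ⊗[ℚ] TA g))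

/-- The generator `Θ(t,u,v,w)`, i.e. `t ⊗ u ⊗ v ⊗ w`. -/
def Th (g : ℕ) (t u v w : TA g) : T4 g := t ⊗ₜ[ℚ] (u ⊗ₜ[ℚ] (v ⊗ₜ[ℚ] w))

/-- The second term `Θ(t̄′, t″u, v̄′, wv″)` of the (GC3) relation
(Sweedler summation implicit). -/
def gc3B (g : ℕ) (t u v w : TA g) : T4 g :=
  (TensorProduct.assoc ℚ (TA g) (TA g) (TA g ⊗[ℚ] TA g))
    ((TensorProduct.map (barT g) (LinearMap.mulRight ℚ u)) (comul g t) ⊗ₜ[ℚ]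
     (TensorProduct.map (barT g) (LinearMap.mulLeft ℚ w)) (comul g v))

/-- The third term `Θ(tu″, ū′, w″v, w̄′)` of the (GC3) relation
(Sweedler summation implicit). -/
def gc3C (g : ℕ) (t u v w : TA g) : T4 g :=
  (TensorProduct.assoc ℚ (TA g) (TA g) (TA g ⊗[ℚ] TA g))
    ((TensorProduct.comm ℚ (TA g) (TA g)
        ((TensorProduct.map (barT g) (LinearMap.mulLeft ℚ t)) (comul g u))) ⊗ₜ[ℚ]
     (TensorProduct.comm ℚ (TA g) (TA g)
        ((TensorProduct.map (barT g) (LinearMap.mulRight ℚ v)) (comul g w))))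

/-- The full (GC3) element `Θ(t,u,v,w) + Θ(t̄′,t″u,v̄′,wv″) + Θ(tu″,ū′,w″v,w̄′)`. -/
def gc3 (g : ℕ) (t u v w : TA g) : T4 g :=
  Th g t u v w + gc3B g t u v w + gc3C g t u v w

/-- The relations (CS), (HB) and (GC3) defining `Ω̃₂`. -/
def OmegaRel (g : ℕ) : Set (T4 g) :=
  {x | (∃ t u v w : TA g,
          x = Th g t u v w - Th g (barT g v) (barT g w) (barT g t) (barT g u)) ∨
       (∃ t u v w : TA g,
          x = Th g t u v w - Th g (barT g u) (barT g t) (barT g w) (barT g v)) ∨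
       (∃ (t u v w : TA g) (a : Hsp g),
          x = Th g t u v (w * TensorAlgebra.ι ℚ a)
              - Th g t u (TensorAlgebra.ι ℚ a * v) w
              - Th g t (TensorAlgebra.ι ℚ a * u) v w
              + Th g (t * TensorAlgebra.ι ℚ a) u v w) ∨
       (∃ t u v w : TA g, x = gc3 g t u v w)}

/-- The 2-loop space `Ω̃₂`. -/
abbrev Omega2 (g : ℕ) : Type := T4 g ⧸ Submodule.span ℚ (OmegaRel g)

/-- The class `Θ(t,u,v,w) ∈ Ω̃₂`. -/
def ThO (g : ℕ) (t u v w : TA g) : Omega2 g := Submodule.Quotient.mk (Th g t u v w)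

/-- The presentation space for `C_{1,2}ℋ`: one copy of `T⊗T⊗T⊗T` for the theta
generators and one for the dumbbell generators. -/
abbrev P2 (g : ℕ) : Type := T4 g × T4 g

/-- The theta generator in the presentation space. -/
def ThP (g : ℕ) (t u v w : TA g) : P2 g := (Th g t u v w, 0)

/-- The dumbbell generator in the presentation space. -/
def DP (g : ℕ) (t u v w : TA g) : P2 g := (0, Th g t u v w)

/-- The relations (CS), (HB) and (CC) defining `C₁₂ = C_{1,2}ℋ`. -/
def C12Rel (g : ℕ) : Set (P2 g) :=
  {x | (∃ t u v w : TA g,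
          x = ThP g t u v w - ThP g (barT g v) (barT g w) (barT g t) (barT g u)) ∨
       (∃ t u v w : TA g,
          x = ThP g t u v w - ThP g (barT g u) (barT g t) (barT g w) (barT g v)) ∨
       (∃ t u v w : TA g,
          x = DP g t u v w - DP g (barT g v) u (barT g t) w) ∨
       (∃ t u v w : TA g,
          x = DP g t u v w - DP g (barT g u) (barT g t) (barT g w) (barT g v)) ∨
       (∃ (t u v w : TA g) (a : Hsp g),
          x = ThP g t u v (w * TensorAlgebra.ι ℚ a)
              - ThP g t u (TensorAlgebra.ι ℚ a * v) w
              - ThP g t (TensorAlgebra.ι ℚ a * u) v w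
              + ThP g (t * TensorAlgebra.ι ℚ a) u v w) ∨
       (∃ (t u v w : TA g) (a : Hsp g),
          x = DP g t u (TensorAlgebra.ι ℚ a * v) w
              - DP g (t * TensorAlgebra.ι ℚ a) u v w
              - DP g t u v (w * TensorAlgebra.ι ℚ a)
              + DP g t (TensorAlgebra.ι ℚ a * u) v w) ∨
       (∃ t u v w : TA g,
          x = DP g t u v w - ThP g t u v w - ThP g (barT g v) u (barT g t) w)}

/-- The space `C₁₂ = C_{1,2}ℋ`. -/
abbrev C12 (g : ℕ) : Type := P2 g ⧸ Submodule.span ℚ (C12Rel g)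

/-- The class `Θ(t,u,v,w) ∈ C₁₂`. -/
def ThC (g : ℕ) (t u v w : TA g) : C12 g := Submodule.Quotient.mk (ThP g t u v w)

/-- The class `D(t,u,v,w) ∈ C₁₂`. -/
def DC (g : ℕ) (t u v w : TA g) : C12 g := Submodule.Quotient.mk (DP g t u v w)

/-- The element `GC3(t,u,v,w) ∈ C₁₂`. -/
def gc3C12 (g : ℕ) (t u v w : TA g) : C12 g :=
  Submodule.Quotient.mk ((gc3 g t u v w, 0) : P2 g)

/-- The degree-`n` component `H^{⊗n}` of the tensor algebra. -/
def TAdeg (g n : ℕ) : Submodule ℚ (TA g) :=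
  (LinearMap.range (TensorAlgebra.ι ℚ : Hsp g →ₗ[ℚ] TA g)) ^ n

/-- The part of `T⊗T⊗T⊗T` of total tensor degree `m`. -/
def T4deg (g m : ℕ) : Submodule ℚ (T4 g) :=
  Submodule.span ℚ {x | ∃ i j k l : ℕ, i + j + k + l = m ∧
    ∃ t ∈ TAdeg g i, ∃ u ∈ TAdeg g j, ∃ v ∈ TAdeg g k, ∃ w ∈ TAdeg g l,
      x = Th g t u v w}

/-- The part `Ω̃₂^{(m)}` of total tensor degree `m`. -/
def Omega2deg (g m : ℕ) : Submodule ℚ (Omega2 g) :=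
  Submodule.map (Submodule.span ℚ (OmegaRel g)).mkQ (T4deg g m)

/-- The part `C₁₂^{(m)}` of total tensor degree `m` (Lie degree `n = m + 2`). -/
def C12deg (g m : ℕ) : Submodule ℚ (C12 g) :=
  Submodule.map (Submodule.span ℚ (C12Rel g)).mkQ ((T4deg g m).prod (T4deg g m))

/-- The functorial action of a linear endomorphism of `H` on the tensor algebra. -/
def TAmap (g : ℕ) (φ : Hsp g →ₗ[ℚ] Hsp g) : TA g →ₐ[ℚ] TA g :=
  TensorAlgebra.lift ℚ (TensorAlgebra.ι ℚ ∘ₗ φ)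

/-- The diagonal action on `T⊗T⊗T⊗T`. -/
def T4map (g : ℕ) (φ : Hsp g →ₗ[ℚ] Hsp g) : T4 g →ₗ[ℚ] T4 g :=
  TensorProduct.map (TAmap g φ).toLinearMap
    (TensorProduct.map (TAmap g φ).toLinearMap
      (TensorProduct.map (TAmap g φ).toLinearMap (TAmap g φ).toLinearMap))

/-- The diagonal action on the presentation space of `C₁₂`. -/
def P2map (g : ℕ) (φ : Hsp g →ₗ[ℚ] Hsp g) : P2 g →ₗ[ℚ] P2 g :=
  (T4map g φ).prodMap (T4map g φ)

/-- The action of `GL(H)` on polynomials, realizing `MvPolynomial (Fin 2g) ℚ` as the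
symmetric algebra `Sym H` via `eᵢ ↦ Xᵢ`. -/
def polyAct (g : ℕ) (σ : Hsp g ≃ₗ[ℚ] Hsp g) :
    MvPolynomial (Fin (2 * g)) ℚ →ₐ[ℚ] MvPolynomial (Fin (2 * g)) ℚ :=
  MvPolynomial.aeval fun i => ∑ j, MvPolynomial.C (σ (Pi.single i 1) j) * MvPolynomial.X j

/-- The `m`-th symmetric power `Sym^m H`, realized as the homogeneous polynomials of
degree `m`. -/
abbrev SymP (g m : ℕ) : Type := ↥(MvPolynomial.homogeneousSubmodule (Fin (2 * g)) ℚ m)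

/-- The space of `GL(H)`-equivariant linear maps `C₁₂^{(m)} → Λ^n H`. -/
def equivC12toLam (g m n : ℕ) :
    Submodule ℚ (↥(C12deg g m) →ₗ[ℚ] ↥(⋀[ℚ]^n (Hsp g))) where
  carrier := {π | ∀ (σ : Hsp g ≃ₗ[ℚ] Hsp g) (p : P2 g)
      (hx : Submodule.Quotient.mk p ∈ C12deg g m)
      (hy : Submodule.Quotient.mk (P2map g σ.toLinearMap p) ∈ C12deg g m),
      (↑(π ⟨Submodule.Quotient.mk (P2map g σ.toLinearMap p), hy⟩) :
          ExteriorAlgebra ℚ (Hsp g))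
        = ExteriorAlgebra.map σ.toLinearMap
            ↑(π ⟨Submodule.Quotient.mk p, hx⟩)}
  add_mem' := by
    intro f₁ f₂ h₁ h₂ σ p hx hy
    simp only [LinearMap.add_apply, Submodule.coe_add, h₁ σ p hx hy, h₂ σ p hx hy, map_add]
  zero_mem' := by
    intro σ p hx hy
    simp
  smul_mem' := by
    intro c f h σ p hx hy
    simp only [LinearMap.smul_apply, SetLike.val_smul, h σ p hx hy, map_smul]

/-- The space of `GL(H)`-equivariant linear maps `Ω̃₂^{(m)} → Λ^n H`. -/
def equivOmega2toLam (g m n : ℕ) :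
    Submodule ℚ (↥(Omega2deg g m) →ₗ[ℚ] ↥(⋀[ℚ]^n (Hsp g))) where
  carrier := {π | ∀ (σ : Hsp g ≃ₗ[ℚ] Hsp g) (x : T4 g)
      (hx : Submodule.Quotient.mk x ∈ Omega2deg g m)
      (hy : Submodule.Quotient.mk (T4map g σ.toLinearMap x) ∈ Omega2deg g m),
      (↑(π ⟨Submodule.Quotient.mk (T4map g σ.toLinearMap x), hy⟩) :
          ExteriorAlgebra ℚ (Hsp g))
        = ExteriorAlgebra.map σ.toLinearMap
            ↑(π ⟨Submodule.Quotient.mk x, hx⟩)}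
  add_mem' := by
    intro f₁ f₂ h₁ h₂ σ p hx hy
    simp only [LinearMap.add_apply, Submodule.coe_add, h₁ σ p hx hy, h₂ σ p hx hy, map_add]
  zero_mem' := by
    intro σ p hx hy
    simp
  smul_mem' := by
    intro c f h σ p hx hy
    simp only [LinearMap.smul_apply, SetLike.val_smul, h σ p hx hy, map_smul]

/-- The space of `GL(H)`-equivariant linear maps `C₁₂^{(m)} → Sym^n H`. -/
def equivC12toSym (g m n : ℕ) :
    Submodule ℚ (↥(C12deg g m) →ₗ[ℚ] SymP g n) where
  carrier := {π | ∀ (σ : Hsp g ≃ₗ[ℚ] Hsp g) (p : P2 g)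
      (hx : Submodule.Quotient.mk p ∈ C12deg g m)
      (hy : Submodule.Quotient.mk (P2map g σ.toLinearMap p) ∈ C12deg g m),
      (↑(π ⟨Submodule.Quotient.mk (P2map g σ.toLinearMap p), hy⟩) :
          MvPolynomial (Fin (2 * g)) ℚ)
        = polyAct g σ ↑(π ⟨Submodule.Quotient.mk p, hx⟩)}
  add_mem' := by
    intro f₁ f₂ h₁ h₂ σ p hx hy
    simp only [LinearMap.add_apply, Submodule.coe_add, h₁ σ p hx hy, h₂ σ p hx hy, map_add]
  zero_mem' := by
    intro σ p hx hy
    simp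
  smul_mem' := by
    intro c f h σ p hx hy
    simp only [LinearMap.smul_apply, SetLike.val_smul, h σ p hx hy, map_smul]

/-- The space of `GL(H)`-equivariant linear maps `Ω̃₂^{(m)} → Sym^n H`. -/
def equivOmega2toSym (g m n : ℕ) :
    Submodule ℚ (↥(Omega2deg g m) →ₗ[ℚ] SymP g n) where
  carrier := {π | ∀ (σ : Hsp g ≃ₗ[ℚ] Hsp g) (x : T4 g)
      (hx : Submodule.Quotient.mk x ∈ Omega2deg g m)
      (hy : Submodule.Quotient.mk (T4map g σ.toLinearMap x) ∈ Omega2deg g m),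
      (↑(π ⟨Submodule.Quotient.mk (T4map g σ.toLinearMap x), hy⟩) :
          MvPolynomial (Fin (2 * g)) ℚ)
        = polyAct g σ ↑(π ⟨Submodule.Quotient.mk x, hx⟩)}
  add_mem' := by
    intro f₁ f₂ h₁ h₂ σ p hx hy
    simp only [LinearMap.add_apply, Submodule.coe_add, h₁ σ p hx hy, h₂ σ p hx hy, map_add]
  zero_mem' := by
    intro σ p hx hy
    simp
  smul_mem' := by
    intro c f h σ p hx hy
    simp only [LinearMap.smul_apply, SetLike.val_smul, h σ p hx hy, map_smul]

/-! ### Monomials in the tensor algebra -/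

/-- The monomial `u₁⋯uₘ` attached to a list of vectors. -/
def mono (g : ℕ) (L : List (Hsp g)) : TA g := (L.map (TensorAlgebra.ι ℚ)).prod

lemma mono_nil (g : ℕ) : mono g [] = 1 := rfl

lemma ι_eq_mono (g : ℕ) (a : Hsp g) : TensorAlgebra.ι ℚ a = mono g [a] := by
  simp [mono]

lemma mono_mul (g : ℕ) (L L' : List (Hsp g)) : mono g L * mono g L' = mono g (L ++ L') := by
  simp [mono]

lemma tprod_eq_mono {g n : ℕ} (v : Fin n → Hsp g) :
    TensorAlgebra.tprod ℚ (Hsp g) n v = mono g (List.ofFn v) := by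
  rw [TensorAlgebra.tprod_apply, mono, List.map_ofFn]
  rfl

lemma TAmap_mono (g : ℕ) (φ : Hsp g →ₗ[ℚ] Hsp g) (L : List (Hsp g)) :
    TAmap g φ (mono g L) = mono g (L.map φ) := by
  simp [mono, TAmap, map_list_prod, Function.comp_def]

lemma barT_mul (g : ℕ) (x y : TA g) : barT g (x * y) = barT g y * barT g x := by
  simp [barT]

lemma barT_ι (g : ℕ) (a : Hsp g) : barT g (TensorAlgebra.ι ℚ a) = -TensorAlgebra.ι ℚ a := by
  simp [barT]

lemma barT_one (g : ℕ) : barT g 1 = 1 := by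
  simp [barT]

lemma barT_mono (g : ℕ) (L : List (Hsp g)) :
    barT g (mono g L) = (-1 : ℚ) ^ L.length • mono g L.reverse := by
  induction L with
  | nil => simp [mono_nil, barT_one]
  | cons a L ih =>
    rw [List.reverse_cons, ← mono_mul, ← List.singleton_append, ← mono_mul, barT_mul, ih,
      ← ι_eq_mono, barT_ι, List.length_append, pow_add]
    simp

lemma mono_mem_TAdeg (g : ℕ) (L : List (Hsp g)) : mono g L ∈ TAdeg g L.length := by
  induction L with
  | nil => simp [mono, TAdeg]
  | cons a L ih =>
    rw [← List.singleton_append, ← mono_mul, ← ι_eq_mono, List.length_append, TAdeg, pow_add]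
    exact Submodule.mul_mem_mul (by simp) ih

/-- A linear map which kills the monomials of degree `n` kills the degree-`n` part. -/
lemma eq_zero_of_mem_TAdeg {g n : ℕ} {N : Type*} [AddCommGroup N] [Module ℚ N]
    (f : TA g →ₗ[ℚ] N) (hf : ∀ L : List (Hsp g), L.length = n → f (mono g L) = 0)
    {t : TA g} (ht : t ∈ TAdeg g n) : f t = 0 := by
  suffices h : TAdeg g n ≤ Submodule.span ℚ {x | ∃ L : List (Hsp g), L.length = n ∧ x = mono g L} by
    have hle : Submodule.span ℚ {x | ∃ L : List (Hsp g), L.length = n ∧ x = mono g L} ≤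
        LinearMap.ker f := by
      rw [Submodule.span_le]
      rintro _ ⟨L, hL, rfl⟩
      exact hf L hL
    exact hle (h ht)
  clear ht hf
  induction n with
  | zero =>
    rw [TAdeg, pow_zero, Submodule.one_le]
    exact Submodule.subset_span ⟨[], rfl, rfl⟩
  | succ n ih =>
    rw [TAdeg, pow_succ, Submodule.mul_le]
    rintro x hx _ ⟨a, rfl⟩
    have hx' := ih hx
    clear hx
    induction hx' using Submodule.span_induction with
    | mem x hx =>
      obtain ⟨L, hL, rfl⟩ := hx
      rw [ι_eq_mono, mono_mul]
      exact Submodule.subset_span ⟨_, by simp [hL], rfl⟩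
    | zero => simp
    | add x y _ _ hx hy =>
      rw [add_mul]
      exact add_mem hx hy
    | smul r x _ hx =>
      rw [smul_mul_assoc]
      exact Submodule.smul_mem _ r hx

/-- Induction on the tensor algebra by linearity from monomials. -/
lemma TA_induction {g : ℕ} {p : TA g → Prop} (hmono : ∀ L, p (mono g L))
    (hadd : ∀ x y, p x → p y → p (x + y)) (hsmul : ∀ (r : ℚ) x, p x → p (r • x)) (x : TA g) :
    p x := by
  have hx : x ∈ Submodule.span ℚ (Submonoid.closure (Set.range (TensorAlgebra.ι ℚ (M := Hsp g))) :
      Set (TA g)) := by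
    rw [← Algebra.adjoin_eq_span, TensorAlgebra.adjoin_range_ι]
    trivial
  induction hx using Submodule.span_induction with
  | mem x hx =>
    obtain ⟨l, hl, rfl⟩ := Submonoid.exists_list_of_mem_closure hx
    obtain ⟨L, rfl⟩ : l ∈ Set.range (List.map (TensorAlgebra.ι ℚ (M := Hsp g))) := by
      rw [Set.range_list_map]
      exact hl
    exact hmono L
  | zero => simpa using hsmul 0 _ (hmono [])
  | add x y _ _ hx hy => exact hadd x y hx hy
  | smul r x _ hx => exact hsmul r x hx

/-! ### Multilinearity of the generators -/

lemma Th_add₁ (g : ℕ) (t t' u v w : TA g) :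
    Th g (t + t') u v w = Th g t u v w + Th g t' u v w := by
  simp [Th, TensorProduct.add_tmul]

lemma Th_add₂ (g : ℕ) (t u u' v w : TA g) :
    Th g t (u + u') v w = Th g t u v w + Th g t u' v w := by
  simp [Th, TensorProduct.add_tmul, TensorProduct.tmul_add]

lemma Th_add₃ (g : ℕ) (t u v v' w : TA g) :
    Th g t u (v + v') w = Th g t u v w + Th g t u v' w := by
  simp [Th, TensorProduct.add_tmul, TensorProduct.tmul_add]

lemma Th_add₄ (g : ℕ) (t u v w w' : TA g) :
    Th g t u v (w + w') = Th g t u v w + Th g t u v w' := by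
  simp [Th, TensorProduct.tmul_add]

lemma Th_smul₁ (g : ℕ) (r : ℚ) (t u v w : TA g) : Th g (r • t) u v w = r • Th g t u v w := by
  simp [Th, TensorProduct.smul_tmul']

lemma Th_smul₂ (g : ℕ) (r : ℚ) (t u v w : TA g) : Th g t (r • u) v w = r • Th g t u v w := by
  simp [Th, ← TensorProduct.smul_tmul']

lemma Th_smul₃ (g : ℕ) (r : ℚ) (t u v w : TA g) : Th g t u (r • v) w = r • Th g t u v w := by
  simp [Th, ← TensorProduct.smul_tmul']

lemma Th_smul₄ (g : ℕ) (r : ℚ) (t u v w : TA g) : Th g t u v (r • w) = r • Th g t u v w := by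
  simp [Th]

/-- The class of a quadruple of monomials. -/
def Thm (g : ℕ) (L₁ L₂ L₃ L₄ : List (Hsp g)) : T4 g :=
  Th g (mono g L₁) (mono g L₂) (mono g L₃) (mono g L₄)

lemma T4map_Thm (g : ℕ) (φ : Hsp g →ₗ[ℚ] Hsp g) (L₁ L₂ L₃ L₄ : List (Hsp g)) :
    T4map g φ (Thm g L₁ L₂ L₃ L₄) = Thm g (L₁.map φ) (L₂.map φ) (L₃.map φ) (L₄.map φ) := by
  simp [T4map, Thm, Th, TAmap_mono]

lemma Thm_mem_T4deg {g m : ℕ} {L₁ L₂ L₃ L₄ : List (Hsp g)}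
    (h : L₁.length + L₂.length + L₃.length + L₄.length = m) : Thm g L₁ L₂ L₃ L₄ ∈ T4deg g m :=
  Submodule.subset_span ⟨_, _, _, _, h, _, mono_mem_TAdeg g L₁, _, mono_mem_TAdeg g L₂, _,
    mono_mem_TAdeg g L₃, _, mono_mem_TAdeg g L₄, rfl⟩

/-- A linear map which kills the quadruples of monomials of total degree `m` kills the part of
total degree `m`. -/
lemma eq_zero_of_mem_T4deg {g m : ℕ} {N : Type*} [AddCommGroup N] [Module ℚ N]
    (f : T4 g →ₗ[ℚ] N) (hf : ∀ L₁ L₂ L₃ L₄ : List (Hsp g),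
      L₁.length + L₂.length + L₃.length + L₄.length = m → f (Thm g L₁ L₂ L₃ L₄) = 0)
    {x : T4 g} (hx : x ∈ T4deg g m) : f x = 0 := by
  refine (Submodule.span_le (p := LinearMap.ker f)).mpr ?_ hx
  rintro _ ⟨i, j, k, l, h, t, ht, u, hu, v, hv, w, hw, rfl⟩
  refine eq_zero_of_mem_TAdeg (f ∘ₗ (TensorProduct.mk ℚ (TA g) _).flip (u ⊗ₜ (v ⊗ₜ w)))
    (fun L₁ h₁ => ?_) ht
  refine eq_zero_of_mem_TAdeg (f ∘ₗ TensorProduct.mk ℚ _ _ (mono g L₁) ∘ₗ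
    (TensorProduct.mk ℚ (TA g) _).flip (v ⊗ₜ w)) (fun L₂ h₂ => ?_) hu
  refine eq_zero_of_mem_TAdeg (f ∘ₗ TensorProduct.mk ℚ _ _ (mono g L₁) ∘ₗ
    TensorProduct.mk ℚ _ _ (mono g L₂) ∘ₗ (TensorProduct.mk ℚ (TA g) _).flip w)
    (fun L₃ h₃ => ?_) hv
  refine eq_zero_of_mem_TAdeg (f ∘ₗ TensorProduct.mk ℚ _ _ (mono g L₁) ∘ₗ
    TensorProduct.mk ℚ _ _ (mono g L₂) ∘ₗ TensorProduct.mk ℚ (TA g) _ (mono g L₃))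
    (fun L₄ h₄ => ?_) hw
  exact hf L₁ L₂ L₃ L₄ (by omega)

/-- Two linear maps on `T⊗T⊗T⊗T` which agree on quadruples of monomials are equal. -/
lemma T4_hom_ext {g : ℕ} {N : Type*} [AddCommGroup N] [Module ℚ N] {f f' : T4 g →ₗ[ℚ] N}
    (h : ∀ L₁ L₂ L₃ L₄ : List (Hsp g), f (Thm g L₁ L₂ L₃ L₄) = f' (Thm g L₁ L₂ L₃ L₄)) :
    f = f' := by
  have key : ∀ t u v w, f (Th g t u v w) = f' (Th g t u v w) := by
    intro t u v w
    induction t using TA_induction with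
    | hadd _ _ h₁ h₂ => simp only [Th_add₁, map_add, h₁, h₂]
    | hsmul _ _ h₁ => simp only [Th_smul₁, map_smul, h₁]
    | hmono L₁ =>
    induction u using TA_induction with
    | hadd _ _ h₁ h₂ => simp only [Th_add₂, map_add, h₁, h₂]
    | hsmul _ _ h₁ => simp only [Th_smul₂, map_smul, h₁]
    | hmono L₂ =>
    induction v using TA_induction with
    | hadd _ _ h₁ h₂ => simp only [Th_add₃, map_add, h₁, h₂]
    | hsmul _ _ h₁ => simp only [Th_smul₃, map_smul, h₁]
    | hmono L₃ =>
    induction w using TA_induction with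
    | hadd _ _ h₁ h₂ => simp only [Th_add₄, map_add, h₁, h₂]
    | hsmul _ _ h₁ => simp only [Th_smul₄, map_smul, h₁]
    | hmono L₄ => exact h L₁ L₂ L₃ L₄
  ext t u v w
  exact key t u v w

/-! ### Equivariant multilinear maps -/

/-- Any linearly independent family is carried to any other by a linear automorphism. -/
lemma LinearIndependent.exists_linearEquiv_apply_eq {K V ι : Type*} [Field K] [AddCommGroup V]
    [Module K V] [Finite ι] {v w : ι → V} (hv : LinearIndependent K v)
    (hw : LinearIndependent K w) : ∃ σ : V ≃ₗ[K] V, ∀ i, σ (v i) = w i := by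
  have : FiniteDimensional K (Submodule.span K (Set.range v)) :=
    FiniteDimensional.span_of_finite K (Set.finite_range v)
  obtain ⟨σ, hσ⟩ := Submodule.exists_linearEquiv_restrict_eq
    ((Module.Basis.span hv).equiv (Module.Basis.span hw) (Equiv.refl ι))
  refine ⟨σ, fun i => ?_⟩
  have h := hσ (Module.Basis.span hv i)
  rw [Module.Basis.equiv_apply, Module.Basis.span_apply, Module.Basis.span_apply] at h
  exact h.symm

/-- A multilinear map on `ℚⁿ` which vanishes on linearly independent families is zero, as soon as
`n` is at least twice the number of arguments. -/
lemma MultilinearMap.eq_zero_of_linearIndependent {n : ℕ} {I N : Type*} [Fintype I] [DecidableEq I]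
    [AddCommGroup N] [Module ℚ N] (hI : 2 * Fintype.card I ≤ n)
    (f : MultilinearMap ℚ (fun _ : I => Fin n → ℚ) N)
    (hf : ∀ v, LinearIndependent ℚ v → f v = 0) : f = 0 := by
  refine Module.Basis.ext_multilinear (fun _ => Pi.basisFun ℚ (Fin n)) fun a => ?_
  obtain ⟨b⟩ : Nonempty (I ↪ {i : Fin n // i ∉ Finset.univ.image a}) := by
    apply Function.Embedding.nonempty_of_card_le
    have h₁ : (Finset.univ.image a).card ≤ Fintype.card I := Finset.card_image_le
    have h₂ := Fintype.card_subtype_compl (fun i => i ∈ Finset.univ.image a)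
    rw [Fintype.card_coe, Fintype.card_fin] at h₂
    omega
  have hab : ∀ i k, a i ≠ (b k : Fin n) := fun i k h =>
    (b k).2 (h ▸ Finset.mem_image_of_mem a (Finset.mem_univ i))
  have hbb : ∀ i k, (b i : Fin n) = b k ↔ i = k := fun i k => by simp [Subtype.coe_inj]
  set A : I → Fin n → ℚ := fun i => Pi.single (a i) 1
  set B : I → Fin n → ℚ := fun i => Pi.single (b i : Fin n) 1
  have hA : (fun i => Pi.basisFun ℚ (Fin n) (a i)) = (A + B) + -B := by
    simp [A]
  rw [hA, MultilinearMap.map_add_univ]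
  refine Finset.sum_eq_zero fun s _ => hf _ ?_
  rw [Fintype.linearIndependent_iff]
  intro c hc k
  have hk := congrFun hc (b k)
  have hsum : ∀ i, (c i • s.piecewise (A + B) (-B) i) (b k : Fin n) =
      if i = k then (if k ∈ s then c k else -c k) else 0 := by
    intro i
    by_cases hs : i ∈ s
    · by_cases hik : i = k
      · subst hik
        simp [hs, A, B, (hab i i).symm]
      · simp [hs, A, B, (hab i k).symm, hik, hbb, Ne.symm hik]
    · by_cases hik : i = k
      · subst hik
        simp [hs, B]
      · simp [hs, B, hik, hbb, Ne.symm hik]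
  simp only [Finset.sum_apply, hsum] at hk
  simp at hk
  split_ifs at hk
  · exact hk
  · simpa using hk

/-- The automorphism of `H` doubling the `i`-th coordinate. -/
def dil (g : ℕ) (i : Fin (2 * g)) : Hsp g ≃ₗ[ℚ] Hsp g :=
  LinearEquiv.piCongrRight fun k => LinearEquiv.smulOfNeZero ℚ ℚ (if k = i then 2 else 1)
    (by split_ifs <;> norm_num)

lemma dil_apply (g : ℕ) (i : Fin (2 * g)) (u : Hsp g) (k : Fin (2 * g)) :
    dil g i u k = if k = i then 2 * u k else u k := by
  by_cases h : k = i <;> simp [dil, h]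

/-- The `i`-th basis vector of `H`, for `i < 5 ≤ g`. -/
def ev {g : ℕ} (hg : 5 ≤ g) (i : Fin 5) : Hsp g := Pi.single (Fin.castLE (by omega) i) 1

/-- The product of the images of a list of vectors under a linear map to an algebra. -/
def jprod {g : ℕ} {A : Type*} [Ring A] [Algebra ℚ A] (j : Hsp g →ₗ[ℚ] A) (L : List (Hsp g)) : A :=
  (L.map j).prod

/-- A quotient algebra of the tensor algebra in which vectors commute up to the sign `ε`, with a
compatible action of `GL(H)`, together with a subrepresentation `M` containing the products of five
vectors, in which the weight space of `e₁⋯e₅` is a line. -/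
structure IsTarget {g : ℕ} (hg : 5 ≤ g) {A : Type*} [Ring A] [Algebra ℚ A]
    (M : Submodule ℚ A) (j : Hsp g →ₗ[ℚ] A) (ρ : (Hsp g ≃ₗ[ℚ] Hsp g) → A →ₐ[ℚ] A)
    (ε : ℚ) : Prop where
  comm : ∀ a b, j a * j b = ε • (j b * j a)
  map_j : ∀ σ a, ρ σ (j a) = j (σ a)
  mem : ∀ L : List (Hsp g), L.length = 5 → jprod j L ∈ M
  ne_zero : jprod j (List.ofFn (ev hg)) ≠ 0
  weight : ∀ x ∈ M, (∀ i : Fin 5, ρ (dil g (Fin.castLE (by omega) i)) x = (2 : ℚ) • x) →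
    ∃ c : ℚ, x = c • jprod j (List.ofFn (ev hg))

section Classification

variable {g : ℕ} {hg : 5 ≤ g} {A : Type*} [Ring A] [Algebra ℚ A]
  {M : Submodule ℚ A} {j : Hsp g →ₗ[ℚ] A} {ρ : (Hsp g ≃ₗ[ℚ] Hsp g) → A →ₐ[ℚ] A} {ε : ℚ}

lemma jprod_append (L L' : List (Hsp g)) : jprod j (L ++ L') = jprod j L * jprod j L' := by
  simp [jprod]

lemma IsTarget.map_jprod (h : IsTarget hg M j ρ ε) (σ : Hsp g ≃ₗ[ℚ] Hsp g) (L : List (Hsp g)) :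
    ρ σ (jprod j L) = jprod j (L.map σ) := by
  simp [jprod, map_list_prod, Function.comp_def, h.map_j]

/-- The multilinear map sending five vectors to the product of their images. -/
def jmulti (j : Hsp g →ₗ[ℚ] A) : MultilinearMap ℚ (fun _ : Fin 5 => Hsp g) A :=
  (MultilinearMap.mkPiAlgebraFin ℚ 5 A).compLinearMap fun _ => j

lemma jmulti_apply (v : Fin 5 → Hsp g) : jmulti j v = jprod j (List.ofFn v) := by
  simp [jmulti, jprod]

/-- An equivariant multilinear map from five vectors to `M` is a multiple of the product. -/
lemma IsTarget.exists_eq_smul (h : IsTarget hg M j ρ ε)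
    (f : MultilinearMap ℚ (fun _ : Fin 5 => Hsp g) A) (hM : ∀ v, f v ∈ M)
    (hf : ∀ (σ : Hsp g ≃ₗ[ℚ] Hsp g) v, f (fun i => σ (v i)) = ρ σ (f v)) :
    ∃ c : ℚ, ∀ v, f v = c • jprod j (List.ofFn v) := by
  obtain ⟨c, hc⟩ := h.weight _ (hM (ev hg)) fun i => by
    rw [← hf]
    have : (fun k => dil g (Fin.castLE (by omega) i) (ev hg k)) =
        Function.update (ev hg) i ((2 : ℚ) • ev hg i) := by
      funext k
      ext l
      by_cases hk : k = i
      · subst hk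
        by_cases hl : l = Fin.castLE (by omega) k <;> simp [dil_apply, ev, hl]
      · have hne : Fin.castLE (by omega : 5 ≤ 2 * g) i ≠ Fin.castLE (by omega) k := by
          simpa [Fin.ext_iff, eq_comm] using hk
        by_cases hl : l = Fin.castLE (by omega) i
        · simp [dil_apply, ev, hl, hk, hne]
        · simp [dil_apply, ev, hl, hk]
    rw [this, MultilinearMap.map_update_smul, Function.update_eq_self]
  refine ⟨c, fun v => ?_⟩
  have hli : LinearIndependent ℚ (ev hg) := by
    have hcomp : ev hg = Pi.basisFun ℚ (Fin (2 * g)) ∘ Fin.castLE (by omega) := by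
      funext i
      simp [ev]
    rw [hcomp]
    exact (Pi.basisFun ℚ (Fin (2 * g))).linearIndependent.comp _ (Fin.castLE_injective (by omega))
  have h0 : f - c • jmulti j = 0 := by
    refine MultilinearMap.eq_zero_of_linearIndependent (by simp; omega) _ fun w hw => ?_
    obtain ⟨σ, hσ⟩ := hli.exists_linearEquiv_apply_eq hw
    obtain rfl : (fun i => σ (ev hg i)) = w := funext hσ
    have hl : (List.ofFn fun i => σ (ev hg i)) = (List.ofFn (ev hg)).map σ := by
      rw [List.map_ofFn]; rfl
    rw [sub_apply, smul_apply, jmulti_apply, hf, hl, ← h.map_jprod,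
      hc, map_smul, sub_self]
  have := congrArg (fun F => F v) h0
  simpa [jmulti_apply, sub_eq_zero] using this

/-- The multilinear map sending `v` to the quadruple of monomials obtained by cutting `v` into
consecutive blocks. -/
def Thmulti (g i j k l : ℕ) :
    MultilinearMap ℚ (fun _ : Fin i ⊕ (Fin j ⊕ (Fin k ⊕ Fin l)) => Hsp g) (T4 g) :=
  (TensorAlgebra.tprod ℚ (Hsp g) i).domCoprod ((TensorAlgebra.tprod ℚ (Hsp g) j).domCoprod
    ((TensorAlgebra.tprod ℚ (Hsp g) k).domCoprod (TensorAlgebra.tprod ℚ (Hsp g) l)))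

/-- On quadruples of monomials of total degree five, an equivariant linear map is given by scalars
depending only on the degrees. -/
def HasCoeff (j : Hsp g →ₗ[ℚ] A) (f : T4 g →ₗ[ℚ] A) (c : ℕ → ℕ → ℕ → ℕ → ℚ) : Prop :=
  ∀ L₁ L₂ L₃ L₄ : List (Hsp g), L₁.length + L₂.length + L₃.length + L₄.length = 5 →
    f (Thm g L₁ L₂ L₃ L₄) = c L₁.length L₂.length L₃.length L₄.length •
      jprod j (L₁ ++ (L₂ ++ (L₃ ++ L₄)))

lemma IsTarget.exists_hasCoeff (h : IsTarget hg M j ρ ε) (f : T4 g →ₗ[ℚ] A)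
    (hM : ∀ x ∈ T4deg g 5, f x ∈ M)
    (hf : ∀ (σ : Hsp g ≃ₗ[ℚ] Hsp g), ∀ x ∈ T4deg g 5, f (T4map g σ.toLinearMap x) = ρ σ (f x)) :
    ∃ c, HasCoeff j f c := by
  have key : ∀ a b c d : ℕ, ∃ r : ℚ, ∀ L₁ L₂ L₃ L₄ : List (Hsp g), L₁.length = a → L₂.length = b →
      L₃.length = c → L₄.length = d → a + b + c + d = 5 → f (Thm g L₁ L₂ L₃ L₄) =
        r • jprod j (L₁ ++ (L₂ ++ (L₃ ++ L₄))) := by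
    intro a b c d
    by_cases h5 : a + b + c + d = 5
    swap
    · exact ⟨0, fun _ _ _ _ _ _ _ _ h => absurd h h5⟩
    let e : Fin a ⊕ (Fin b ⊕ (Fin c ⊕ Fin d)) ≃ Fin 5 :=
      ((Equiv.sumCongr (Equiv.refl _) ((Equiv.sumCongr (Equiv.refl _) finSumFinEquiv).trans
        finSumFinEquiv)).trans finSumFinEquiv).trans (finCongr (by omega))
    have hF : ∀ v, Thmulti g a b c d v = Thm g (List.ofFn fun i => v (.inl i))
        (List.ofFn fun i => v (.inr (.inl i))) (List.ofFn fun i => v (.inr (.inr (.inl i))))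
        (List.ofFn fun i => v (.inr (.inr (.inr i)))) := by
      intro v
      simp only [Thmulti, MultilinearMap.domCoprod_apply, tprod_eq_mono, Thm, Th]
    obtain ⟨r, hr⟩ := h.exists_eq_smul (f.compMultilinearMap ((Thmulti g a b c d).domDomCongr e))
      (fun v => hM _ (by
        rw [MultilinearMap.domDomCongr_apply, hF]
        exact Thm_mem_T4deg (by simpa using h5)))
      (fun σ v => by
        simp only [LinearMap.compMultilinearMap_apply, MultilinearMap.domDomCongr_apply, hF]
        rw [← hf σ _ (Thm_mem_T4deg (by simpa using h5)), T4map_Thm]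
        simp [List.map_ofFn, Function.comp_def])
    refine ⟨r, fun L₁ L₂ L₃ L₄ h₁ h₂ h₃ h₄ _ => ?_⟩
    subst h₁ h₂ h₃ h₄
    set w : Fin L₁.length ⊕ (Fin L₂.length ⊕ (Fin L₃.length ⊕ Fin L₄.length)) → Hsp g :=
      Sum.elim L₁.get (Sum.elim L₂.get (Sum.elim L₃.get L₄.get)) with hw
    have hr' := hr (fun i => w (e.symm i))
    have hl : (List.ofFn fun i => w (e.symm i)) = L₁ ++ (L₂ ++ (L₃ ++ L₄)) := by
      rw [List.ofFn_congr (show 5 = L₁.length + (L₂.length + (L₃.length + L₄.length)) by omega)]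
      have hinl : ∀ (m n : ℕ) (h : m ≤ m + n) (i : Fin m),
          finSumFinEquiv.symm (Fin.castLE h i) = Sum.inl i :=
        fun m n _ i => finSumFinEquiv_symm_apply_castAdd i
      simp [List.ofFn_add, e, hw, hinl]
    rw [hl] at hr'
    rw [← hr']
    simp [hF, hw]
  choose c hc using key
  exact ⟨c, fun L₁ L₂ L₃ L₄ h5 => hc _ _ _ _ _ _ _ _ rfl rfl rfl rfl h5⟩

end Classification

section Signs

variable {g : ℕ} {A : Type*} [Ring A] [Algebra ℚ A] {j : Hsp g →ₗ[ℚ] A} {ε : ℚ}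
  {f : T4 g →ₗ[ℚ] A} {c : ℕ → ℕ → ℕ → ℕ → ℚ}

/-! ### Signs of permutations of products -/

lemma jprod_cons_comm (hj : ∀ a b, j a * j b = ε • (j b * j a)) (a : Hsp g) (L : List (Hsp g)) :
    jprod j (a :: L) = ε ^ L.length • jprod j (L ++ [a]) := by
  induction L with
  | nil => simp
  | cons b L ih =>
    have h₁ : jprod j (a :: b :: L) = j a * j b * jprod j L := by simp [jprod, mul_assoc]
    have h₂ : jprod j (b :: L ++ [a]) = j b * jprod j (L ++ [a]) := by simp [jprod]
    have h₃ : j b * jprod j (a :: L) = j b * j a * jprod j L := by simp [jprod, mul_assoc]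
    rw [h₁, h₂, hj, smul_mul_assoc, ← h₃, ih, mul_smul_comm, smul_smul, List.length_cons, pow_succ']

lemma jprod_append_comm (hj : ∀ a b, j a * j b = ε • (j b * j a)) (L L' : List (Hsp g)) :
    jprod j (L ++ L') = ε ^ (L.length * L'.length) • jprod j (L' ++ L) := by
  induction L generalizing L' with
  | nil => simp
  | cons a L ih =>
    have h : j a * jprod j (L' ++ L) = jprod j (a :: L') * jprod j L := by simp [jprod, mul_assoc]
    have h' : jprod j (L' ++ [a]) * jprod j L = jprod j (L' ++ a :: L) := by simp [jprod, mul_assoc]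
    rw [← List.singleton_append, List.append_assoc, jprod_append, ih, mul_smul_comm]
    rw [show jprod j [a] = j a by simp [jprod], h, jprod_cons_comm hj, smul_mul_assoc, smul_smul,
      h', ← pow_add, List.singleton_append, List.length_cons, Nat.succ_mul]

lemma jprod_reverse (hj : ∀ a b, j a * j b = ε • (j b * j a)) (L : List (Hsp g)) :
    jprod j L.reverse = ε ^ L.length.choose 2 • jprod j L := by
  induction L with
  | nil => simp
  | cons a L ih =>
    have h₁ : jprod j (a :: L.reverse) = j a * jprod j L.reverse := by simp [jprod]
    have h₂ : jprod j (a :: L) = j a * jprod j L := by simp [jprod]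
    have h₃ := jprod_append_comm hj L.reverse [a]
    rw [List.reverse_cons, h₃, List.singleton_append, h₁, ih, mul_smul_comm, smul_smul, h₂,
      ← pow_add, List.length_cons (as := L), Nat.choose_succ_succ' _ 1]
    simp

/-- The exponent of `ε` produced by reversing each of four blocks. -/
def revExp (i j k l : ℕ) : ℕ := i.choose 2 + j.choose 2 + k.choose 2 + l.choose 2

lemma jprod_reverse_four (hj : ∀ a b, j a * j b = ε • (j b * j a))
    (L₁ L₂ L₃ L₄ : List (Hsp g)) :
    jprod j (L₁.reverse ++ (L₂.reverse ++ (L₃.reverse ++ L₄.reverse))) =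
      ε ^ revExp L₁.length L₂.length L₃.length L₄.length • jprod j (L₁ ++ (L₂ ++ (L₃ ++ L₄))) := by
  simp only [jprod_append, jprod_reverse hj, smul_mul_assoc, mul_smul_comm, smul_smul, ← pow_add,
    revExp]
  congr 2
  ring

lemma Th_barT (g : ℕ) (L₁ L₂ L₃ L₄ : List (Hsp g)) :
    Th g (barT g (mono g L₁)) (barT g (mono g L₂)) (barT g (mono g L₃)) (barT g (mono g L₄)) =
      (-1 : ℚ) ^ (L₁.length + L₂.length + L₃.length + L₄.length) •
        Thm g L₁.reverse L₂.reverse L₃.reverse L₄.reverse := by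
  simp only [barT_mono, Th_smul₁, Th_smul₂, Th_smul₃, Th_smul₄, smul_smul, Thm, pow_add]
  congr 1
  ring

/-! ### Values of the relators -/

lemma HasCoeff.flip (hc : HasCoeff j f c) (hj : ∀ a b, j a * j b = ε • (j b * j a))
    {L₁ L₂ L₃ L₄ : List (Hsp g)} (h5 : L₁.length + L₂.length + L₃.length + L₄.length = 5) :
    f (Th g (barT g (mono g L₃)) (barT g (mono g L₄)) (barT g (mono g L₁)) (barT g (mono g L₂))) =
      (-(ε ^ (revExp L₁.length L₂.length L₃.length L₄.length +
          (L₃.length + L₄.length) * (L₁.length + L₂.length)) *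
        c L₃.length L₄.length L₁.length L₂.length)) • jprod j (L₁ ++ (L₂ ++ (L₃ ++ L₄))) := by
  rw [Th_barT, map_smul, hc _ _ _ _ (by simp; omega), ← List.append_assoc,
    jprod_append_comm hj, List.append_assoc, jprod_reverse_four hj,
    show L₃.length + L₄.length + L₁.length + L₂.length = 5 by omega]
  simp only [smul_smul, List.length_reverse, List.length_append]
  congr 1
  ring

lemma HasCoeff.turn (hc : HasCoeff j f c) (hj : ∀ a b, j a * j b = ε • (j b * j a))
    {L₁ L₂ L₃ L₄ : List (Hsp g)} (h5 : L₁.length + L₂.length + L₃.length + L₄.length = 5) :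
    f (Th g (barT g (mono g L₂)) (barT g (mono g L₁)) (barT g (mono g L₄)) (barT g (mono g L₃))) =
      (-(ε ^ (revExp L₁.length L₂.length L₃.length L₄.length +
          L₂.length * L₁.length + L₄.length * L₃.length) *
        c L₂.length L₁.length L₄.length L₃.length)) • jprod j (L₁ ++ (L₂ ++ (L₃ ++ L₄))) := by
  rw [Th_barT, map_smul, hc _ _ _ _ (by simp; omega), ← List.append_assoc, jprod_append,
    jprod_append_comm hj, jprod_append_comm hj L₄.reverse, smul_mul_smul_comm, ← jprod_append,
    List.append_assoc, jprod_reverse_four hj,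
    show L₂.length + L₁.length + L₄.length + L₃.length = 5 by omega]
  simp only [smul_smul, List.length_reverse]
  congr 1
  ring

lemma HasCoeff.cross (hc : HasCoeff j f c) (hj : ∀ a b, j a * j b = ε • (j b * j a))
    {L₁ L₂ L₃ L₄ : List (Hsp g)} (h5 : L₁.length + L₂.length + L₃.length + L₄.length = 5) :
    f (Th g (barT g (mono g L₃)) (mono g L₂) (barT g (mono g L₁)) (mono g L₄)) =
      ((-1) ^ (L₁.length + L₃.length) * ε ^ (L₁.length.choose 2 + L₃.length.choose 2 +
          L₃.length * (L₂.length + L₁.length) + L₂.length * L₁.length) *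
        c L₃.length L₂.length L₁.length L₄.length) • jprod j (L₁ ++ (L₂ ++ (L₃ ++ L₄))) := by
  have h : Th g (barT g (mono g L₃)) (mono g L₂) (barT g (mono g L₁)) (mono g L₄) =
      (-1 : ℚ) ^ (L₁.length + L₃.length) • Thm g L₃.reverse L₂ L₁.reverse L₄ := by
    simp only [barT_mono, Th_smul₁, Th_smul₃, smul_smul, Thm, pow_add]
  have hp : jprod j (L₃.reverse ++ (L₂ ++ (L₁.reverse ++ L₄))) =
      ε ^ (L₁.length.choose 2 + L₃.length.choose 2 +
          L₃.length * (L₂.length + L₁.length) + L₂.length * L₁.length) •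
        jprod j (L₁ ++ (L₂ ++ (L₃ ++ L₄))) := by
    rw [← List.append_assoc L₂, ← List.append_assoc, jprod_append, jprod_append_comm hj,
      List.append_assoc, ← List.append_assoc, jprod_append, jprod_append_comm hj L₂]
    simp only [jprod_append, jprod_reverse hj, smul_mul_assoc, mul_smul_comm, smul_smul,
      List.length_append, List.length_reverse, ← pow_add, mul_assoc]
    congr 2
    ring
  rw [h, map_smul, hc _ _ _ _ (by simp; omega), hp]
  simp only [smul_smul, List.length_reverse]
  congr 1
  ring

lemma HasCoeff.hair₁ (hc : HasCoeff j f c) (hj : ∀ a b, j a * j b = ε • (j b * j a))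
    {L₁ L₂ L₃ L₄ : List (Hsp g)} (a : Hsp g)
    (h4 : L₁.length + L₂.length + L₃.length + L₄.length = 4) :
    f (Th g (mono g L₁ * TensorAlgebra.ι ℚ a) (mono g L₂) (mono g L₃) (mono g L₄)) =
      (ε ^ (L₂.length + L₃.length + L₄.length) *
        c (L₁.length + 1) L₂.length L₃.length L₄.length) •
          jprod j (L₁ ++ (L₂ ++ (L₃ ++ (L₄ ++ [a])))) := by
  rw [ι_eq_mono, mono_mul]
  refine (hc _ _ _ _ (by simp; omega)).trans ?_
  rw [List.append_assoc, jprod_append, List.singleton_append, jprod_cons_comm hj]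
  simp only [List.append_assoc, mul_smul_comm, smul_smul, ← jprod_append, List.length_append,
    List.length_singleton, add_assoc]
  rw [mul_comm]

lemma HasCoeff.hair₂ (hc : HasCoeff j f c) (hj : ∀ a b, j a * j b = ε • (j b * j a))
    {L₁ L₂ L₃ L₄ : List (Hsp g)} (a : Hsp g)
    (h4 : L₁.length + L₂.length + L₃.length + L₄.length = 4) :
    f (Th g (mono g L₁) (TensorAlgebra.ι ℚ a * mono g L₂) (mono g L₃) (mono g L₄)) =
      (ε ^ (L₂.length + L₃.length + L₄.length) *
        c L₁.length (L₂.length + 1) L₃.length L₄.length) •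
          jprod j (L₁ ++ (L₂ ++ (L₃ ++ (L₄ ++ [a])))) := by
  rw [ι_eq_mono, mono_mul]
  refine (hc _ _ _ _ (by simp; omega)).trans ?_
  rw [jprod_append, List.singleton_append, List.cons_append, jprod_cons_comm hj]
  simp only [List.append_assoc, mul_smul_comm, smul_smul, ← jprod_append, List.length_append,
    List.length_cons, add_assoc]
  rw [mul_comm]

lemma HasCoeff.hair₃ (hc : HasCoeff j f c) (hj : ∀ a b, j a * j b = ε • (j b * j a))
    {L₁ L₂ L₃ L₄ : List (Hsp g)} (a : Hsp g)
    (h4 : L₁.length + L₂.length + L₃.length + L₄.length = 4) :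
    f (Th g (mono g L₁) (mono g L₂) (TensorAlgebra.ι ℚ a * mono g L₃) (mono g L₄)) =
      (ε ^ (L₃.length + L₄.length) *
        c L₁.length L₂.length (L₃.length + 1) L₄.length) •
          jprod j (L₁ ++ (L₂ ++ (L₃ ++ (L₄ ++ [a])))) := by
  rw [ι_eq_mono, mono_mul]
  refine (hc _ _ _ _ (by simp; omega)).trans ?_
  rw [jprod_append, jprod_append, List.singleton_append, List.cons_append, jprod_cons_comm hj]
  simp only [List.append_assoc, mul_smul_comm, smul_smul, ← jprod_append, List.length_append,
    List.length_cons]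
  rw [mul_comm]

lemma HasCoeff.hair₄ (hc : HasCoeff j f c) {L₁ L₂ L₃ L₄ : List (Hsp g)} (a : Hsp g)
    (h4 : L₁.length + L₂.length + L₃.length + L₄.length = 4) :
    f (Th g (mono g L₁) (mono g L₂) (mono g L₃) (mono g L₄ * TensorAlgebra.ι ℚ a)) =
      c L₁.length L₂.length L₃.length (L₄.length + 1) •
          jprod j (L₁ ++ (L₂ ++ (L₃ ++ (L₄ ++ [a])))) := by
  rw [ι_eq_mono, mono_mul]
  refine (hc _ _ _ _ (by simp; omega)).trans ?_
  rw [List.length_append, List.length_singleton]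

end Signs

/-! ### The linear system for the coefficients -/

/-- The linear equations on coefficients which express the relations (CS) and (HB) for `Θ`. -/
structure IsSol (ε : ℚ) (c : ℕ → ℕ → ℕ → ℕ → ℚ) : Prop where
  flip : ∀ i j k l, i + j + k + l = 5 →
    c i j k l = -(ε ^ (revExp i j k l + (k + l) * (i + j)) * c k l i j)
  turn : ∀ i j k l, i + j + k + l = 5 →
    c i j k l = -(ε ^ (revExp i j k l + j * i + l * k) * c j i l k)
  hair : ∀ i j k l, i + j + k + l = 4 →
    c i j k (l + 1) - ε ^ (k + l) * c i j (k + 1) l - ε ^ (j + k + l) * c i (j + 1) k l +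
      ε ^ (j + k + l) * c (i + 1) j k l = 0

/-- The linear equations on coefficients which express the relations (CS) and (HB) for `D`, and
the relation (CC). -/
structure IsSolD (ε : ℚ) (c d : ℕ → ℕ → ℕ → ℕ → ℚ) : Prop where
  cross : ∀ i j k l, i + j + k + l = 5 →
    d i j k l = (-1) ^ (i + k) * ε ^ (i.choose 2 + k.choose 2 + k * (j + i) + j * i) * d k j i l
  turn : ∀ i j k l, i + j + k + l = 5 →
    d i j k l = -(ε ^ (revExp i j k l + j * i + l * k) * d j i l k)
  hair : ∀ i j k l, i + j + k + l = 4 →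
    ε ^ (k + l) * d i j (k + 1) l - ε ^ (j + k + l) * d (i + 1) j k l - d i j k (l + 1) +
      ε ^ (j + k + l) * d i (j + 1) k l = 0
  cc : ∀ i j k l, i + j + k + l = 5 →
    d i j k l = c i j k l +
      (-1) ^ (i + k) * ε ^ (i.choose 2 + k.choose 2 + k * (j + i) + j * i) * c k j i l

/-! ### Solving the linear system -/

lemma IsSol.eq_zero_of_reps {ε : ℚ} {c : ℕ → ℕ → ℕ → ℕ → ℚ} (h : IsSol ε c)
    (hr : ∀ i j k l, i + j + k + l = 5 → k ≤ i → l ≤ i → j ≤ i → c i j k l = 0)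
    (i j k l : ℕ) (h5 : i + j + k + l = 5) : c i j k l = 0 := by
  have key : ∀ i j k l, i + j + k + l = 5 → j ≤ i → l ≤ i → c i j k l = 0 := by
    intro i j k l h5 h₁ h₂
    rcases le_total k i with h₃ | h₃
    · exact hr i j k l h5 h₃ h₂ h₁
    · rw [h.flip i j k l h5, hr k l i j (by omega) h₃ (by omega) (by omega)]
      simp
  have key' : ∀ i j k l, i + j + k + l = 5 → j ≤ i → c i j k l = 0 := by
    intro i j k l h5 h₁
    rcases le_total l i with h₂ | h₂
    · exact key i j k l h5 h₁ h₂
    · rcases le_total l k with h₃ | h₃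
      · rw [h.flip i j k l h5, key k l i j (by omega) h₃ (by omega)]
        simp
      · rw [h.flip i j k l h5, h.turn k l i j (by omega), key l k j i (by omega) h₃ h₂]
        simp
  rcases le_total j i with h₁ | h₁
  · exact key' i j k l h5 h₁
  · rw [h.turn i j k l h5, key' j i l k (by omega) h₁]
    simp

/-- A solution is determined by three of its coefficients. -/
lemma IsSol.eq_zero {ε : ℚ} (hε : ε = 1 ∨ ε = -1) {c : ℕ → ℕ → ℕ → ℕ → ℚ} (h : IsSol ε c)
    (hp : c 4 0 1 0 = 0) (hq : c 4 1 0 0 = 0) (hr : c 5 0 0 0 = 0) (i j k l : ℕ)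
    (h5 : i + j + k + l = 5) : c i j k l = 0 := by
  refine h.eq_zero_of_reps (fun i j k l h5 h₁ h₂ h₃ => ?_) i j k l h5
  have e₁ := h.hair 4 0 0 0 rfl
  have e₂ := h.hair 3 1 0 0 rfl
  have e₃ := h.hair 3 0 1 0 rfl
  have e₄ := h.hair 3 0 0 1 rfl
  have e₅ := h.hair 2 2 0 0 rfl
  have e₆ := h.hair 2 1 1 0 rfl
  have e₇ := h.hair 2 1 0 1 rfl
  have e₈ := h.hair 2 0 2 0 rfl
  have e₉ := h.hair 2 0 1 1 rfl
  have e₁₀ := h.hair 2 0 0 2 rfl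
  have e₁₁ := h.hair 1 1 1 1 rfl
  have s₁ := h.turn 2 3 0 0 rfl
  have s₂ := h.flip 2 0 3 0 rfl
  have s₃ := h.flip 2 0 0 3 rfl
  have s₄ := h.turn 0 3 2 0 rfl
  have s₅ := h.turn 1 2 1 1 rfl
  have s₆ := h.flip 1 1 2 1 rfl
  have s₇ := h.turn 1 1 1 2 rfl
  have s₈ := h.flip 2 0 2 1 rfl
  have s₉ := h.turn 2 2 0 1 rfl
  have s₁₀ := h.turn 2 0 1 2 rfl
  have s₁₁ := h.flip 0 2 2 1 rfl
  rcases hε with rfl | rfl <;>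
  · norm_num [hp, hq, hr] at e₁ e₂ e₃ e₄ e₅ e₆ e₇ e₈ e₉ e₁₀ e₁₁
    norm_num [revExp, Nat.choose] at s₁ s₂ s₃ s₄ s₅ s₆ s₇ s₈ s₉ s₁₀ s₁₁
    have hi : i ≤ 5 := by omega
    have hj : j ≤ 2 := by omega
    have hk : k ≤ 2 := by omega
    obtain rfl : l = 5 - i - j - k := by omega
    interval_cases i <;> interval_cases j <;> interval_cases k <;> first | omega | linarith

/-- Ten times the values of the solutions of the system on representatives of the orbits of its
symmetries, as linear forms in the values at `(4, 0, 1, 0)`, `(4, 1, 0, 0)` and `(5, 0, 0, 0)`. -/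
def solRep (ε : ℤ) : ℕ → ℕ → ℕ → ℕ → ℤ × ℤ × ℤ
  | 5, 0, 0, 0 => (0, 0, 10)
  | 4, 1, 0, 0 => (0, 10, 0)
  | 4, 0, 1, 0 => (10, 0, 0)
  | 4, 0, 0, 1 => (10, 10, -10)
  | 3, 2, 0, 0 => (0, 5 * ε, 2 - 3 * ε)
  | 3, 1, 1, 0 => (5, 5 * ε, -1 - ε)
  | 3, 1, 0, 1 => (5, 5 - 5 * ε, ε - 4)
  | 3, 0, 2, 0 => (5 * ε, 0, 2 - 3 * ε)
  | 3, 0, 1, 1 => (5 - 5 * ε, 5, ε - 4)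
  | 3, 0, 0, 2 => (-5, -5, 2 + 2 * ε)
  | 2, 2, 1, 0 => (0, 5 * ε, 2 - 3 * ε)
  | 2, 1, 2, 0 => (5 * ε, 0, 2 - 3 * ε)
  | 2, 1, 0, 2 => (-5, -5, 2 + 2 * ε)
  | _, _, _, _ => 0

/-- Ten times the general solution of the system. -/
def solForm (ε : ℤ) (i j k l : ℕ) : ℤ × ℤ × ℤ :=
  solRep ε i j k l - ε ^ (revExp i j k l + (k + l) * (i + j)) • solRep ε k l i j -
    ε ^ (revExp i j k l + j * i + l * k) • solRep ε j i l k +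
    ε ^ ((k + l) * (i + j) + j * i + l * k) • solRep ε l k j i

/-- The equations of the system, for linear forms. -/
lemma solForm_flip {ε : ℤ} (hε : ε = 1 ∨ ε = -1) : ∀ i j k l : Fin 6,
    (i + j + k + l : ℕ) = 5 → solForm ε i j k l =
      -(ε ^ (revExp i j k l + (k + l) * (i + j)) • solForm ε k l i j) := by
  rcases hε with rfl | rfl <;> decide +kernel

lemma solForm_turn {ε : ℤ} (hε : ε = 1 ∨ ε = -1) : ∀ i j k l : Fin 6,
    (i + j + k + l : ℕ) = 5 → solForm ε i j k l =
      -(ε ^ (revExp i j k l + j * i + l * k) • solForm ε j i l k) := by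
  rcases hε with rfl | rfl <;> decide +kernel

lemma solForm_hair {ε : ℤ} (hε : ε = 1 ∨ ε = -1) : ∀ i j k l : Fin 5,
    (i + j + k + l : ℕ) = 4 → solForm ε i j k (l + 1) - ε ^ (k + l : ℕ) • solForm ε i j (k + 1) l -
      ε ^ (j + k + l : ℕ) • solForm ε i (j + 1) k l +
      ε ^ (j + k + l : ℕ) • solForm ε (i + 1) j k l = 0 := by
  rcases hε with rfl | rfl <;> decide +kernel

/-- The value of a linear form, divided by ten. -/
def formEval (p q r : ℚ) : ℤ × ℤ × ℤ →+ ℚ where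
  toFun x := (x.1 * p + x.2.1 * q + x.2.2 * r) / 10
  map_zero' := by simp
  map_add' x y := by
    simp only [Prod.fst_add, Prod.snd_add, Int.cast_add]
    ring

lemma formEval_zsmul (p q r : ℚ) (n : ℤ) (x : ℤ × ℤ × ℤ) :
    formEval p q r (n • x) = n * formEval p q r x := by
  rw [map_zsmul, zsmul_eq_mul]

/-- The solution with three prescribed coefficients. -/
def sol (ε : ℤ) (p q r : ℚ) (i j k l : ℕ) : ℚ := formEval p q r (solForm ε i j k l)

lemma isSol_sol {ε : ℤ} (hε : ε = 1 ∨ ε = -1) (p q r : ℚ) : IsSol ε (sol ε p q r) where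
  flip i j k l h := by
    simpa only [sol, map_neg, map_add, map_sub, map_zero, formEval_zsmul, Int.cast_pow]
      using congrArg (formEval p q r)
      (solForm_flip hε ⟨i, by omega⟩ ⟨j, by omega⟩ ⟨k, by omega⟩ ⟨l, by omega⟩ h)
  turn i j k l h := by
    simpa only [sol, map_neg, map_add, map_sub, map_zero, formEval_zsmul, Int.cast_pow]
      using congrArg (formEval p q r)
      (solForm_turn hε ⟨i, by omega⟩ ⟨j, by omega⟩ ⟨k, by omega⟩ ⟨l, by omega⟩ h)
  hair i j k l h := by
    simpa only [sol, map_neg, map_add, map_sub, map_zero, formEval_zsmul, Int.cast_pow]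
      using congrArg (formEval p q r)
      (solForm_hair hε ⟨i, by omega⟩ ⟨j, by omega⟩ ⟨k, by omega⟩ ⟨l, by omega⟩ h)

/-- The coefficients on `D` determined by those on `Θ`. -/
def solD (ε : ℚ) (c : ℕ → ℕ → ℕ → ℕ → ℚ) (i j k l : ℕ) : ℚ :=
  c i j k l + (-1) ^ (i + k) * ε ^ (i.choose 2 + k.choose 2 + k * (j + i) + j * i) * c k j i l

lemma pow_mul_self_eq_one {ε : ℚ} (hε : ε = 1 ∨ ε = -1) (n : ℕ) : ε ^ n * ε ^ n = 1 := by
  rw [← mul_pow]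
  rcases hε with rfl | rfl <;> norm_num

lemma pow_eq_pow_of_even {ε : ℚ} (hε : ε = 1 ∨ ε = -1) {m n : ℕ} (h : Even (m + n)) :
    ε ^ m = ε ^ n := by
  obtain ⟨r, hr⟩ := h
  have h₁ := pow_mul_self_eq_one hε n
  have h₂ := pow_mul_self_eq_one hε r
  rw [← pow_add] at h₂
  rw [← hr, pow_add] at h₂
  linear_combination ε ^ n * h₂ - ε ^ m * h₁

lemma IsSol.isSolD {ε : ℚ} (hε : ε = 1 ∨ ε = -1) {c : ℕ → ℕ → ℕ → ℕ → ℚ} (h : IsSol ε c) :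
    IsSolD ε c (solD ε c) where
  cross i j k l _ := by
    have h₁ := pow_mul_self_eq_one hε (i.choose 2 + k.choose 2 + k * (j + i) + j * i)
    have h₂ := pow_mul_self_eq_one (Or.inr rfl : (-1 : ℚ) = 1 ∨ (-1 : ℚ) = -1) (i + k)
    simp only [solD, show k.choose 2 + i.choose 2 + i * (j + k) + j * k =
      i.choose 2 + k.choose 2 + k * (j + i) + j * i by ring, add_comm k i]
    generalize ε ^ (i.choose 2 + k.choose 2 + k * (j + i) + j * i) = x at *
    generalize (-1 : ℚ) ^ (i + k) = y at *
    linear_combination (-c i j k l) * (h₂ + y * y * h₁)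
  turn i j k l h5 := by
    have h₁ := h.turn i j k l h5
    have h₂ := h.flip k j i l (by omega)
    have h₃ := h.turn i l k j (by omega)
    have h₅ : (-1 : ℚ) ^ (i + k) = -(-1) ^ (j + l) := by
      have := pow_eq_pow_of_even (Or.inr rfl : (-1 : ℚ) = 1 ∨ (-1 : ℚ) = -1)
        (m := i + k) (n := j + l + 1) ⟨3, by omega⟩
      rw [this, pow_succ]
      ring
    have h₆ : ε ^ (i.choose 2 + k.choose 2 + k * (j + i) + j * i) *
        (ε ^ (revExp k j i l + (i + l) * (k + j)) * ε ^ (revExp i l k j + l * i + j * k)) =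
        ε ^ (revExp i j k l + j * i + l * k) *
          ε ^ (j.choose 2 + l.choose 2 + l * (i + j) + i * j) := by
      simp only [← pow_add]
      refine pow_eq_pow_of_even hε ⟨2 * (i.choose 2 + j.choose 2 + k.choose 2 + l.choose 2) +
        k * j + k * i + j * i * 2 + l * i + l * k + l * j, ?_⟩
      simp only [revExp]
      ring
    simp only [solD, h₅, h₂, h₃, h₁]
    linear_combination (-(-1) ^ (j + l) * c l i j k) * h₆
  hair i j k l h4 := by
    have h₁ := h.hair i j k l h4
    have h₂ := h.hair k j i l (by omega)
    have hc : ∀ n : ℕ, (n + 1).choose 2 = n + n.choose 2 := fun n => by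
      simp [Nat.choose_succ_succ' n 1]
    have e₁ : ε ^ (k + l) * ε ^ (i.choose 2 + (k + 1).choose 2 + (k + 1) * (j + i) + j * i) =
        ε ^ (i.choose 2 + k.choose 2 + k * (j + i) + j * i) * ε ^ (j + i + l) := by
      simp only [← pow_add, hc]
      exact pow_eq_pow_of_even hε ⟨i.choose 2 + k.choose 2 + k * (j + i) + j * i + k + l + j + i,
        by ring⟩
    have e₂ : ε ^ (j + k + l) * ε ^ ((i + 1).choose 2 + k.choose 2 + k * (j + (i + 1)) +
        j * (i + 1)) =
        ε ^ (i.choose 2 + k.choose 2 + k * (j + i) + j * i) * ε ^ (i + l) := by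
      simp only [← pow_add, hc]
      exact pow_eq_pow_of_even hε ⟨i.choose 2 + k.choose 2 + k * (j + i) + j * i + k + l + j + i,
        by ring⟩
    have e₃ : ε ^ (j + k + l) * ε ^ (i.choose 2 + k.choose 2 + k * (j + 1 + i) + (j + 1) * i) =
        ε ^ (i.choose 2 + k.choose 2 + k * (j + i) + j * i) * ε ^ (j + i + l) := by
      simp only [← pow_add]
      exact pow_eq_pow_of_even hε ⟨i.choose 2 + k.choose 2 + k * (j + i) + j * i + k + l + j + i,
        by ring⟩
    have s₁ : (-1 : ℚ) ^ (i + (k + 1)) = -(-1) ^ (i + k) := by rw [← add_assoc, pow_succ]; ring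
    have s₂ : (-1 : ℚ) ^ (i + 1 + k) = -(-1) ^ (i + k) := by rw [add_right_comm, pow_succ]; ring
    simp only [solD, s₁, s₂]
    generalize (-1 : ℚ) ^ (i + k) = σ
    generalize ε ^ (i.choose 2 + k.choose 2 + k * (j + i) + j * i) = y at *
    generalize ε ^ (i.choose 2 + (k + 1).choose 2 + (k + 1) * (j + i) + j * i) = y₁ at *
    generalize ε ^ ((i + 1).choose 2 + k.choose 2 + k * (j + (i + 1)) + j * (i + 1)) = y₂ at *
    generalize ε ^ (i.choose 2 + k.choose 2 + k * (j + 1 + i) + (j + 1) * i) = y₃ at *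
    linear_combination -h₁ - σ * y * h₂ - σ * c (k + 1) j i l * e₁ + σ * c k j (i + 1) l * e₂ +
      σ * c k (j + 1) i l * e₃
  cc _ _ _ _ _ := rfl

lemma IsSol.sub {ε : ℚ} {c c' : ℕ → ℕ → ℕ → ℕ → ℚ} (h : IsSol ε c) (h' : IsSol ε c') :
    IsSol ε (fun i j k l => c i j k l - c' i j k l) where
  flip i j k l h5 := by linear_combination h.flip i j k l h5 - h'.flip i j k l h5
  turn i j k l h5 := by linear_combination h.turn i j k l h5 - h'.turn i j k l h5
  hair i j k l h4 := by linear_combination h.hair i j k l h4 - h'.hair i j k l h4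

lemma sol_values {ε : ℤ} (hε : ε = 1 ∨ ε = -1) (p q r : ℚ) :
    sol ε p q r 4 0 1 0 = p ∧ sol ε p q r 4 1 0 0 = q ∧ sol ε p q r 5 0 0 0 = r := by
  have h : solForm ε 4 0 1 0 = (10, 0, 0) ∧ solForm ε 4 1 0 0 = (0, 10, 0) ∧
      solForm ε 5 0 0 0 = (0, 0, 10) := by
    rcases hε with rfl | rfl <;> decide +kernel
  simp [sol, h, formEval]

lemma IsSol.eq_sol {ε : ℤ} (hε : ε = 1 ∨ ε = -1) {c : ℕ → ℕ → ℕ → ℕ → ℚ} (h : IsSol ε c)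
    (i j k l : ℕ) (h5 : i + j + k + l = 5) :
    c i j k l = sol ε (c 4 0 1 0) (c 4 1 0 0) (c 5 0 0 0) i j k l := by
  obtain ⟨hp, hq, hr⟩ := sol_values hε (c 4 0 1 0) (c 4 1 0 0) (c 5 0 0 0)
  refine sub_eq_zero.1 ((h.sub (isSol_sol hε _ _ _)).eq_zero ?_ (by simp [hp]) (by simp [hq])
    (by simp [hr]) i j k l h5)
  exact_mod_cast hε

/-! ### The relation (GC3) in degree five -/

lemma comul_mul (g : ℕ) (x y : TA g) : comul g (x * y) = comul g x * comul g y := by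
  simp [comul]

lemma comul_mono_nil (g : ℕ) : comul g (mono g []) = mono g [] ⊗ₜ mono g [] := by
  simp [comul, mono_nil, Algebra.TensorProduct.one_def]

lemma comul_mono_singleton (g : ℕ) (a : Hsp g) :
    comul g (mono g [a]) = mono g [a] ⊗ₜ mono g [] + mono g [] ⊗ₜ mono g [a] := by
  simp [comul, mono_nil, ← ι_eq_mono]

lemma comul_mono_pair (g : ℕ) (a b : Hsp g) :
    comul g (mono g [a, b]) = mono g [a, b] ⊗ₜ mono g [] + mono g [a] ⊗ₜ mono g [b] +
      mono g [b] ⊗ₜ mono g [a] + mono g [] ⊗ₜ mono g [a, b] := by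
  rw [show [a, b] = [a] ++ [b] from rfl, ← mono_mul, comul_mul, comul_mono_singleton,
    comul_mono_singleton]
  simp only [mul_add, add_mul, Algebra.TensorProduct.tmul_mul_tmul, mono_mul, List.append_nil,
    List.nil_append]
  abel

section

variable {g : ℕ} {A : Type*} [Ring A] [Algebra ℚ A] {j : Hsp g →ₗ[ℚ] A} {ε : ℚ}
  {f : T4 g →ₗ[ℚ] A} {c : ℕ → ℕ → ℕ → ℕ → ℚ}

lemma tmul_eq_Thm (L₁ L₂ L₃ L₄ : List (Hsp g)) :
    mono g L₁ ⊗ₜ[ℚ] (mono g L₂ ⊗ₜ[ℚ] (mono g L₃ ⊗ₜ[ℚ] mono g L₄)) = Thm g L₁ L₂ L₃ L₄ := rfl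

lemma jprod_swap (hj : ∀ a b, j a * j b = ε • (j b * j a)) (a b : Hsp g) (x : A) :
    j a * (j b * x) = ε • (j b * (j a * x)) := by
  rw [← mul_assoc, hj, smul_mul_assoc, mul_assoc]

lemma HasCoeff.gc3_one_one_one_two (hc : HasCoeff j f c)
    (hj : ∀ a b, j a * j b = ε • (j b * j a)) (a b x y z : Hsp g) :
    f (gc3 g (mono g [a]) (mono g [b]) (mono g [x]) (mono g [y, z])) =
      ((2 - ε) * c 1 1 1 2 - c 0 2 1 2 - ε ^ 2 * c 1 1 0 3 + ε ^ 2 * c 0 2 0 3 + ε * c 2 0 1 2 +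
        (ε ^ 2 + ε) * c 1 1 2 1 - (ε ^ 2 + ε) * c 2 0 2 1 - ε ^ 2 * c 1 1 3 0 +
        ε ^ 2 * c 2 0 3 0) • jprod j [a, b, x, y, z] := by
  have hc' : ∀ L₁ L₂ L₃ L₄ : List (Hsp g), L₁.length + L₂.length + L₃.length + L₄.length = 5 →
    f (Thm g L₁ L₂ L₃ L₄) = c L₁.length L₂.length L₃.length L₄.length •
      jprod j (L₁ ++ (L₂ ++ (L₃ ++ L₄))) := hc
  simp only [gc3, gc3B, gc3C, comul_mono_singleton, comul_mono_pair, map_add,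
    TensorProduct.map_tmul, barT_mono, LinearMap.mulRight_apply, LinearMap.mulLeft_apply, mono_mul,
    TensorProduct.comm_tmul, TensorProduct.add_tmul, TensorProduct.tmul_add,
    ← TensorProduct.smul_tmul', TensorProduct.tmul_smul, map_smul, TensorProduct.assoc_tmul,
    tmul_eq_Thm, Th, List.reverse_cons, List.reverse_nil, List.nil_append, List.cons_append,
    List.length_cons, List.length_nil]
  simp only [hc', List.length_cons, List.length_nil, Nat.reduceAdd, List.cons_append,
    List.nil_append, jprod, List.map_cons, List.map_nil, List.prod_cons, List.prod_nil, mul_one,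
    hj z y, hj z x, jprod_swap hj z x, jprod_swap hj y x, mul_smul_comm]
  module

lemma HasCoeff.gc3_zero_one_two_two (hc : HasCoeff j f c)
    (hj : ∀ a b, j a * j b = ε • (j b * j a)) (a b x y z : Hsp g) :
    f (gc3 g (mono g []) (mono g [a]) (mono g [b, x]) (mono g [y, z])) =
      (c 0 1 2 2 - (ε ^ 3 + ε ^ 2) * c 0 1 1 3 + ε ^ 4 * c 0 1 0 4 + ε * c 1 0 2 2 +
        (ε ^ 3 + ε ^ 2) * c 0 1 3 1 - (ε ^ 3 + ε ^ 2) * c 1 0 3 1 - ε ^ 4 * c 0 1 4 0 +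
        ε ^ 4 * c 1 0 4 0) • jprod j [a, b, x, y, z] := by
  have hc' : ∀ L₁ L₂ L₃ L₄ : List (Hsp g), L₁.length + L₂.length + L₃.length + L₄.length = 5 →
    f (Thm g L₁ L₂ L₃ L₄) = c L₁.length L₂.length L₃.length L₄.length •
      jprod j (L₁ ++ (L₂ ++ (L₃ ++ L₄))) := hc
  simp only [gc3, gc3B, gc3C, comul_mono_nil, comul_mono_singleton, comul_mono_pair, map_add,
    TensorProduct.map_tmul, barT_mono, LinearMap.mulRight_apply, LinearMap.mulLeft_apply, mono_mul,
    TensorProduct.comm_tmul, TensorProduct.add_tmul, TensorProduct.tmul_add,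
    ← TensorProduct.smul_tmul', TensorProduct.tmul_smul, map_smul, TensorProduct.assoc_tmul,
    tmul_eq_Thm, Th, List.reverse_cons, List.reverse_nil, List.nil_append, List.cons_append,
    List.length_cons, List.length_nil]
  simp only [hc', List.length_cons, List.length_nil, Nat.reduceAdd, List.cons_append,
    List.nil_append, jprod, List.map_cons, List.map_nil, List.prod_cons, List.prod_nil, mul_one,
    jprod_swap hj x b, jprod_swap hj y b, jprod_swap hj y x, hj z b, jprod_swap hj z b, hj z x,
    jprod_swap hj z x, hj z y, mul_smul_comm]
  module

lemma HasCoeff.gc3_zero_two_one_two (hc : HasCoeff j f c)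
    (hj : ∀ a b, j a * j b = ε • (j b * j a)) (a b x y z : Hsp g) :
    f (gc3 g (mono g []) (mono g [a, b]) (mono g [x]) (mono g [y, z])) =
      (ε ^ 2 * c 0 2 0 3 + ε * (ε * c 0 2 1 2 - (ε ^ 2 + ε) * c 0 2 2 1 + ε ^ 2 * c 0 2 3 0) -
        (1 + ε) * (ε * c 1 1 1 2 - (ε ^ 2 + ε) * c 1 1 2 1 + ε ^ 2 * c 1 1 3 0) +
        (ε * c 2 0 1 2 - (ε ^ 2 + ε) * c 2 0 2 1 + ε ^ 2 * c 2 0 3 0)) • jprod j [a, b, x, y, z] := by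
  have hc' : ∀ L₁ L₂ L₃ L₄ : List (Hsp g), L₁.length + L₂.length + L₃.length + L₄.length = 5 →
    f (Thm g L₁ L₂ L₃ L₄) = c L₁.length L₂.length L₃.length L₄.length •
      jprod j (L₁ ++ (L₂ ++ (L₃ ++ L₄))) := hc
  simp only [gc3, gc3B, gc3C, comul_mono_nil, comul_mono_singleton, comul_mono_pair, map_add,
    TensorProduct.map_tmul, barT_mono, LinearMap.mulRight_apply, LinearMap.mulLeft_apply, mono_mul,
    TensorProduct.comm_tmul, TensorProduct.add_tmul, TensorProduct.tmul_add,
    ← TensorProduct.smul_tmul', TensorProduct.tmul_smul, map_smul, TensorProduct.assoc_tmul,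
    tmul_eq_Thm, Th, List.reverse_cons, List.reverse_nil, List.nil_append, List.cons_append,
    List.length_cons, List.length_nil]
  simp only [hc', List.length_cons, List.length_nil, Nat.reduceAdd, List.cons_append,
    List.nil_append, jprod, List.map_cons, List.map_nil, List.prod_cons, List.prod_nil, mul_one,
    jprod_swap hj b a, jprod_swap hj y x, hj z x, jprod_swap hj z x, hj z y, mul_smul_comm]
  module


end

/-- A solution of the system which satisfies the equations coming from (GC3) vanishes. -/
lemma IsSol.eq_zero_of_gc3 {ε : ℤ} (hε : ε = 1 ∨ ε = -1) {c : ℕ → ℕ → ℕ → ℕ → ℚ} (h : IsSol ε c)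
    (h₁ : (2 - ε) * c 1 1 1 2 - c 0 2 1 2 - ε ^ 2 * c 1 1 0 3 + ε ^ 2 * c 0 2 0 3 + ε * c 2 0 1 2 +
      (ε ^ 2 + ε) * c 1 1 2 1 - (ε ^ 2 + ε) * c 2 0 2 1 - ε ^ 2 * c 1 1 3 0 +
      ε ^ 2 * c 2 0 3 0 = 0)
    (h₂ : c 0 1 2 2 - (ε ^ 3 + ε ^ 2) * c 0 1 1 3 + ε ^ 4 * c 0 1 0 4 + ε * c 1 0 2 2 +
      (ε ^ 3 + ε ^ 2) * c 0 1 3 1 - (ε ^ 3 + ε ^ 2) * c 1 0 3 1 - ε ^ 4 * c 0 1 4 0 +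
      ε ^ 4 * c 1 0 4 0 = 0)
    (h₃ : ε ^ 2 * c 0 2 0 3 + ε * (ε * c 0 2 1 2 - (ε ^ 2 + ε) * c 0 2 2 1 + ε ^ 2 * c 0 2 3 0) -
      (1 + ε) * (ε * c 1 1 1 2 - (ε ^ 2 + ε) * c 1 1 2 1 + ε ^ 2 * c 1 1 3 0) +
      (ε * c 2 0 1 2 - (ε ^ 2 + ε) * c 2 0 2 1 + ε ^ 2 * c 2 0 3 0) = 0)
    (i j k l : ℕ) (h5 : i + j + k + l = 5) : c i j k l = 0 := by
  obtain ⟨p, q, r, hs⟩ : ∃ p q r, ∀ i j k l, i + j + k + l = 5 → c i j k l = sol ε p q r i j k l :=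
    ⟨_, _, _, h.eq_sol hε⟩
  have h0 : p = 0 ∧ q = 0 ∧ r = 0 := by
    simp only [hs, Nat.reduceAdd] at h₁ h₂ h₃
    rcases hε with rfl | rfl
    all_goals
      norm_num [sol, solForm, solRep, formEval, revExp, Nat.choose] at h₁ h₂ h₃
      refine ⟨?_, ?_, ?_⟩ <;> linarith
  obtain ⟨rfl, rfl, rfl⟩ := h0
  simp [hs _ _ _ _ h5, sol, formEval]

/-! ### Relations force the linear system -/

lemma List.exists_append_four {α : Type*} (L : List α) {i j k l : ℕ}
    (h : i + j + k + l = L.length) : ∃ L₁ L₂ L₃ L₄ : List α, L₁ ++ (L₂ ++ (L₃ ++ L₄)) = L ∧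
      L₁.length = i ∧ L₂.length = j ∧ L₃.length = k ∧ L₄.length = l := by
  refine ⟨L.take i, (L.drop i).take j, ((L.drop i).drop j).take k, ((L.drop i).drop j).drop k,
    ?_, ?_, ?_, ?_, ?_⟩
  · simp only [List.take_append_drop]
  all_goals simp only [List.length_take, List.length_drop]; omega

section

variable {g : ℕ} {hg : 5 ≤ g} {A : Type*} [Ring A] [Algebra ℚ A]
  {M : Submodule ℚ A} {j : Hsp g →ₗ[ℚ] A} {ρ : (Hsp g ≃ₗ[ℚ] Hsp g) → A →ₐ[ℚ] A} {ε : ℚ}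
  {f : T4 g →ₗ[ℚ] A} {c : ℕ → ℕ → ℕ → ℕ → ℚ}

lemma IsTarget.isSol (h : IsTarget hg M j ρ ε) (hc : HasCoeff j f c)
    (hflip : ∀ t u v w, f (Th g t u v w) = f (Th g (barT g v) (barT g w) (barT g t) (barT g u)))
    (hturn : ∀ t u v w, f (Th g t u v w) = f (Th g (barT g u) (barT g t) (barT g w) (barT g v)))
    (hhair : ∀ t u v w a, f (Th g t u v (w * TensorAlgebra.ι ℚ a)) -
      f (Th g t u (TensorAlgebra.ι ℚ a * v) w) - f (Th g t (TensorAlgebra.ι ℚ a * u) v w) +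
      f (Th g (t * TensorAlgebra.ι ℚ a) u v w) = 0) : IsSol ε c where
  flip i₁ i₂ i₃ i₄ h5 := by
    obtain ⟨L₁, L₂, L₃, L₄, hL, rfl, rfl, rfl, rfl⟩ :=
      (List.ofFn (ev hg)).exists_append_four (h5.trans (by simp))
    refine smul_left_injective ℚ (hL ▸ h.ne_zero) ?_
    exact (hc _ _ _ _ h5).symm.trans ((hflip _ _ _ _).trans (hc.flip h.comm h5))
  turn i₁ i₂ i₃ i₄ h5 := by
    obtain ⟨L₁, L₂, L₃, L₄, hL, rfl, rfl, rfl, rfl⟩ :=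
      (List.ofFn (ev hg)).exists_append_four (h5.trans (by simp))
    refine smul_left_injective ℚ (hL ▸ h.ne_zero) ?_
    exact (hc _ _ _ _ h5).symm.trans ((hturn _ _ _ _).trans (hc.turn h.comm h5))
  hair i₁ i₂ i₃ i₄ h4 := by
    obtain ⟨L₁, L₂, L₃, L₄', hL, rfl, rfl, rfl, h₄⟩ :=
      (List.ofFn (ev hg)).exists_append_four (i := i₁) (j := i₂) (k := i₃) (l := i₄ + 1)
      (by simp; omega)
    obtain ⟨L₄, a, rfl⟩ : ∃ L a, L₄' = L ++ [a] :=
      ⟨_, _, (List.dropLast_append_getLast (by rintro rfl; simp at h₄)).symm⟩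
    obtain rfl : i₄ = L₄.length := by simpa using h₄.symm
    refine smul_left_injective ℚ (hL ▸ h.ne_zero) ?_
    have e := hhair (mono g L₁) (mono g L₂) (mono g L₃) (mono g L₄) a
    rw [hc.hair₁ h.comm a h4, hc.hair₂ h.comm a h4, hc.hair₃ h.comm a h4, hc.hair₄ a h4] at e
    simpa only [← sub_smul, ← add_smul, zero_smul] using e

end

/-! ### Construction of equivariant maps -/

section Construction

variable {g : ℕ} {A : Type*} [Ring A] [Algebra ℚ A]

/-- The linear map sending a monomial of degree `n` to the product of the images of its letters, and
every other monomial to zero. -/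
def jdeg (j : Hsp g →ₗ[ℚ] A) (n : ℕ) : TA g →ₗ[ℚ] A :=
  (Polynomial.lcoeff A n).restrictScalars ℚ ∘ₗ
    (TensorAlgebra.lift ℚ ((Polynomial.monomial (R := A) 1).restrictScalars ℚ ∘ₗ j)).toLinearMap

lemma jdeg_mono (j : Hsp g →ₗ[ℚ] A) (n : ℕ) (L : List (Hsp g)) :
    jdeg j n (mono g L) = if L.length = n then jprod j L else 0 := by
  have h : TensorAlgebra.lift ℚ ((Polynomial.monomial (R := A) 1).restrictScalars ℚ ∘ₗ j)
      (mono g L) = Polynomial.monomial L.length (jprod j L) := by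
    induction L with
    | nil => simp [mono_nil, jprod]
    | cons a L ih =>
      rw [← List.singleton_append, ← mono_mul, map_mul, ih, ← ι_eq_mono, TensorAlgebra.lift_ι_apply]
      simp [Polynomial.monomial_mul_monomial, jprod, add_comm]
  simp [jdeg, h, Polynomial.coeff_monomial]

/-- The linear map with prescribed coefficients on quadruples of monomials of total degree five, and
vanishing on quadruples of monomials of other degrees. -/
def coeffMap (j : Hsp g →ₗ[ℚ] A) (c : ℕ → ℕ → ℕ → ℕ → ℚ) : T4 g →ₗ[ℚ] A :=
  ∑ x ∈ Finset.Nat.antidiagonalTuple 4 5, c (x 0) (x 1) (x 2) (x 3) •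
    (LinearMap.mul' ℚ A ∘ₗ TensorProduct.map (jdeg j (x 0))
      (LinearMap.mul' ℚ A ∘ₗ TensorProduct.map (jdeg j (x 1))
        (LinearMap.mul' ℚ A ∘ₗ TensorProduct.map (jdeg j (x 2)) (jdeg j (x 3)))))

lemma coeffMap_Thm (j : Hsp g →ₗ[ℚ] A) (c : ℕ → ℕ → ℕ → ℕ → ℚ) (L₁ L₂ L₃ L₄ : List (Hsp g)) :
    coeffMap j c (Thm g L₁ L₂ L₃ L₄) =
      if L₁.length + L₂.length + L₃.length + L₄.length = 5 then
        c L₁.length L₂.length L₃.length L₄.length • jprod j (L₁ ++ (L₂ ++ (L₃ ++ L₄)))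
      else 0 := by
  have h : ∀ x : Fin 4 → ℕ, (LinearMap.mul' ℚ A ∘ₗ TensorProduct.map (jdeg j (x 0))
      (LinearMap.mul' ℚ A ∘ₗ TensorProduct.map (jdeg j (x 1))
        (LinearMap.mul' ℚ A ∘ₗ TensorProduct.map (jdeg j (x 2)) (jdeg j (x 3)))))
      (Thm g L₁ L₂ L₃ L₄) = if x = ![L₁.length, L₂.length, L₃.length, L₄.length] then
        jprod j (L₁ ++ (L₂ ++ (L₃ ++ L₄))) else 0 := by
    intro x
    have hx : x = ![L₁.length, L₂.length, L₃.length, L₄.length] ↔ L₁.length = x 0 ∧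
        L₂.length = x 1 ∧ L₃.length = x 2 ∧ L₄.length = x 3 := by
      simp [funext_iff, Fin.forall_fin_succ, eq_comm]
    simp only [hx, Thm, Th, LinearMap.comp_apply, TensorProduct.map_tmul, LinearMap.mul'_apply,
      jdeg_mono, jprod_append]
    by_cases h₁ : L₁.length = x 0 <;> by_cases h₂ : L₂.length = x 1 <;>
      by_cases h₃ : L₃.length = x 2 <;> by_cases h₄ : L₄.length = x 3 <;>
      simp [h₁, h₂, h₃, h₄]
  simp only [coeffMap, LinearMap.sum_apply, LinearMap.smul_apply, h, smul_ite, smul_zero,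
    Finset.sum_ite_eq', Finset.Nat.mem_antidiagonalTuple]
  simp [Fin.sum_univ_four]

attribute [irreducible] coeffMap

lemma hasCoeff_coeffMap (j : Hsp g →ₗ[ℚ] A) (c : ℕ → ℕ → ℕ → ℕ → ℚ) :
    HasCoeff j (coeffMap j c) c := fun L₁ L₂ L₃ L₄ h5 => by rw [coeffMap_Thm, if_pos h5]

/-- A function of four tensors which is linear in each of them and vanishes on monomials is zero. -/
lemma eq_zero_of_mono {F : TA g → TA g → TA g → TA g → A}
    (h₁ : ∀ (r : ℚ) t t' u v w, F (r • t + t') u v w = r • F t u v w + F t' u v w)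
    (h₂ : ∀ (r : ℚ) t u u' v w, F t (r • u + u') v w = r • F t u v w + F t u' v w)
    (h₃ : ∀ (r : ℚ) t u v v' w, F t u (r • v + v') w = r • F t u v w + F t u v' w)
    (h₄ : ∀ (r : ℚ) t u v w w', F t u v (r • w + w') = r • F t u v w + F t u v w')
    (h : ∀ L₁ L₂ L₃ L₄, F (mono g L₁) (mono g L₂) (mono g L₃) (mono g L₄) = 0) (t u v w : TA g) :
    F t u v w = 0 := by
  have key : ∀ G : TA g → A, (∀ (r : ℚ) x y, G (r • x + y) = r • G x + G y) →
      (∀ L, G (mono g L) = 0) → ∀ x, G x = 0 := by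
    intro G hG hm x
    have h0 : G 0 = 0 := by simpa using hG 1 0 0
    induction x using TA_induction with
    | hmono L => exact hm L
    | hadd x y hx hy => simpa [hx, hy] using hG 1 x y
    | hsmul r x hx => simpa [hx, h0] using hG r x 0
  refine key (fun t => F t u v w) (fun r x y => h₁ r x y u v w) (fun L₁ => ?_) t
  refine key (fun u => F _ u v w) (fun r x y => h₂ r _ x y v w) (fun L₂ => ?_) u
  refine key (fun v => F _ _ v w) (fun r x y => h₃ r _ _ x y w) (fun L₃ => ?_) v
  exact key _ (fun r x y => h₄ r _ _ _ x y) (fun L₄ => h L₁ L₂ L₃ L₄) w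

variable {j : Hsp g →ₗ[ℚ] A} {ε : ℚ} {c d : ℕ → ℕ → ℕ → ℕ → ℚ}

lemma coeffMap_flip (hj : ∀ a b, j a * j b = ε • (j b * j a))
    (h : ∀ i j k l, i + j + k + l = 5 →
      c i j k l = -(ε ^ (revExp i j k l + (k + l) * (i + j)) * c k l i j)) (t u v w : TA g) :
    coeffMap j c (Th g t u v w) -
      coeffMap j c (Th g (barT g v) (barT g w) (barT g t) (barT g u)) = 0 := by
  refine eq_zero_of_mono (F := fun t u v w => coeffMap j c (Th g t u v w) -
      coeffMap j c (Th g (barT g v) (barT g w) (barT g t) (barT g u))) ?_ ?_ ?_ ?_ ?_ t u v w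
  iterate 4
    intros
    simp only [map_add, map_smul, Th_add₁, Th_add₂, Th_add₃, Th_add₄, Th_smul₁, Th_smul₂, Th_smul₃,
      Th_smul₄]
    module
  intro L₁ L₂ L₃ L₄
  have hc := hasCoeff_coeffMap j c
  by_cases h5 : L₁.length + L₂.length + L₃.length + L₄.length = 5
  · rw [hc.flip hj h5, ← h _ _ _ _ h5]
    exact sub_eq_zero.2 (hc _ _ _ _ h5)
  · rw [Th_barT, map_smul]
    refine sub_eq_zero.2 ((coeffMap_Thm _ _ _ _ _ _).trans ?_)
    rw [coeffMap_Thm, if_neg h5, if_neg (by simp; omega), smul_zero]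

lemma coeffMap_turn (hj : ∀ a b, j a * j b = ε • (j b * j a))
    (h : ∀ i j k l, i + j + k + l = 5 →
      c i j k l = -(ε ^ (revExp i j k l + j * i + l * k) * c j i l k)) (t u v w : TA g) :
    coeffMap j c (Th g t u v w) -
      coeffMap j c (Th g (barT g u) (barT g t) (barT g w) (barT g v)) = 0 := by
  refine eq_zero_of_mono (F := fun t u v w => coeffMap j c (Th g t u v w) -
      coeffMap j c (Th g (barT g u) (barT g t) (barT g w) (barT g v))) ?_ ?_ ?_ ?_ ?_ t u v w
  iterate 4
    intros
    simp only [map_add, map_smul, Th_add₁, Th_add₂, Th_add₃, Th_add₄, Th_smul₁, Th_smul₂, Th_smul₃,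
      Th_smul₄]
    module
  intro L₁ L₂ L₃ L₄
  have hc := hasCoeff_coeffMap j c
  by_cases h5 : L₁.length + L₂.length + L₃.length + L₄.length = 5
  · rw [hc.turn hj h5, ← h _ _ _ _ h5]
    exact sub_eq_zero.2 (hc _ _ _ _ h5)
  · rw [Th_barT, map_smul]
    refine sub_eq_zero.2 ((coeffMap_Thm _ _ _ _ _ _).trans ?_)
    rw [coeffMap_Thm, if_neg h5, if_neg (by simp; omega), smul_zero]

lemma coeffMap_cross_mono_of_ne {L₁ L₂ L₃ L₄ : List (Hsp g)}
    (h5 : L₁.length + L₂.length + L₃.length + L₄.length ≠ 5) :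
    coeffMap j c (Th g (barT g (mono g L₃)) (mono g L₂) (barT g (mono g L₁)) (mono g L₄)) = 0 := by
  simp only [barT_mono, Th_smul₁, Th_smul₃, map_smul]
  refine (congrArg _ (congrArg _ (coeffMap_Thm _ _ _ _ _ _))).trans ?_
  rw [if_neg (by simp; omega), smul_zero, smul_zero]

lemma coeffMap_cross (hj : ∀ a b, j a * j b = ε • (j b * j a))
    (h : ∀ i j k l, i + j + k + l = 5 → d i j k l = (-1) ^ (i + k) *
      ε ^ (i.choose 2 + k.choose 2 + k * (j + i) + j * i) * d k j i l) (t u v w : TA g) :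
    coeffMap j d (Th g t u v w) - coeffMap j d (Th g (barT g v) u (barT g t) w) = 0 := by
  refine eq_zero_of_mono (F := fun t u v w => coeffMap j d (Th g t u v w) -
      coeffMap j d (Th g (barT g v) u (barT g t) w)) ?_ ?_ ?_ ?_ ?_ t u v w
  iterate 4
    intros
    simp only [map_add, map_smul, Th_add₁, Th_add₂, Th_add₃, Th_add₄, Th_smul₁, Th_smul₂, Th_smul₃,
      Th_smul₄]
    module
  intro L₁ L₂ L₃ L₄
  have hd := hasCoeff_coeffMap j d
  by_cases h5 : L₁.length + L₂.length + L₃.length + L₄.length = 5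
  · rw [hd.cross hj h5, ← h _ _ _ _ h5]
    exact sub_eq_zero.2 (hd _ _ _ _ h5)
  · rw [coeffMap_cross_mono_of_ne h5, sub_zero]
    exact (coeffMap_Thm _ _ _ _ _ _).trans (if_neg h5)

lemma coeffMap_cc (hj : ∀ a b, j a * j b = ε • (j b * j a))
    (h : ∀ i j k l, i + j + k + l = 5 → d i j k l = c i j k l + (-1) ^ (i + k) *
      ε ^ (i.choose 2 + k.choose 2 + k * (j + i) + j * i) * c k j i l) (t u v w : TA g) :
    coeffMap j d (Th g t u v w) - coeffMap j c (Th g t u v w) -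
      coeffMap j c (Th g (barT g v) u (barT g t) w) = 0 := by
  refine eq_zero_of_mono (F := fun t u v w => coeffMap j d (Th g t u v w) -
      coeffMap j c (Th g t u v w) - coeffMap j c (Th g (barT g v) u (barT g t) w))
      ?_ ?_ ?_ ?_ ?_ t u v w
  iterate 4
    intros
    simp only [map_add, map_smul, Th_add₁, Th_add₂, Th_add₃, Th_add₄, Th_smul₁, Th_smul₂, Th_smul₃,
      Th_smul₄]
    module
  intro L₁ L₂ L₃ L₄
  by_cases h5 : L₁.length + L₂.length + L₃.length + L₄.length = 5
  · rw [(hasCoeff_coeffMap j c).cross hj h5]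
    refine (congrArg₂ (fun x y => x - y - _) (hasCoeff_coeffMap j d _ _ _ _ h5)
      (hasCoeff_coeffMap j c _ _ _ _ h5)).trans ?_
    simp only [h _ _ _ _ h5, ← sub_smul]
    simp
  · rw [coeffMap_cross_mono_of_ne h5, sub_zero]
    refine (congrArg₂ (· - ·) (coeffMap_Thm _ _ _ _ _ _) (coeffMap_Thm _ _ _ _ _ _)).trans ?_
    simp [h5]

lemma coeffMap_hair (hj : ∀ a b, j a * j b = ε • (j b * j a))
    (h : ∀ i j k l, i + j + k + l = 4 →
      c i j k (l + 1) - ε ^ (k + l) * c i j (k + 1) l - ε ^ (j + k + l) * c i (j + 1) k l +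
      ε ^ (j + k + l) * c (i + 1) j k l = 0) (t u v w : TA g) (a : Hsp g) :
    coeffMap j c (Th g t u v (w * TensorAlgebra.ι ℚ a)) -
      coeffMap j c (Th g t u (TensorAlgebra.ι ℚ a * v) w) -
      coeffMap j c (Th g t (TensorAlgebra.ι ℚ a * u) v w) +
      coeffMap j c (Th g (t * TensorAlgebra.ι ℚ a) u v w) = 0 := by
  refine eq_zero_of_mono (F := fun t u v w =>
    coeffMap j c (Th g t u v (w * TensorAlgebra.ι ℚ a)) -
      coeffMap j c (Th g t u (TensorAlgebra.ι ℚ a * v) w) -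
      coeffMap j c (Th g t (TensorAlgebra.ι ℚ a * u) v w) +
      coeffMap j c (Th g (t * TensorAlgebra.ι ℚ a) u v w)) ?_ ?_ ?_ ?_ ?_ t u v w
  iterate 4
    intros
    simp only [mul_add, add_mul, smul_mul_assoc, mul_smul_comm, map_add, map_smul, Th_add₁, Th_add₂,
      Th_add₃, Th_add₄, Th_smul₁, Th_smul₂, Th_smul₃, Th_smul₄]
    module
  intro L₁ L₂ L₃ L₄
  have hc := hasCoeff_coeffMap j c
  by_cases h4 : L₁.length + L₂.length + L₃.length + L₄.length = 4
  · rw [hc.hair₁ hj a h4, hc.hair₂ hj a h4, hc.hair₃ hj a h4, hc.hair₄ a h4, ← sub_smul,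
      ← sub_smul, ← add_smul, h _ _ _ _ h4, zero_smul]
  · have h0 : ∀ L₁' L₂' L₃' L₄' : List (Hsp g),
        L₁'.length + L₂'.length + L₃'.length + L₄'.length ≠ 5 →
        coeffMap j c (Th g (mono g L₁') (mono g L₂') (mono g L₃') (mono g L₄')) = 0 :=
      fun _ _ _ _ h5 => (coeffMap_Thm _ _ _ _ _ _).trans (if_neg h5)
    simp only [ι_eq_mono, mono_mul]
    rw [h0, h0, h0, h0]
    · simp
    all_goals simp; omega

lemma IsTarget.coeffMap_mem {hg : 5 ≤ g} {M : Submodule ℚ A}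
    {ρ : (Hsp g ≃ₗ[ℚ] Hsp g) → A →ₐ[ℚ] A} (h : IsTarget hg M j ρ ε) (x : T4 g) :
    coeffMap j c x ∈ M := by
  have h0 : M.mkQ ∘ₗ coeffMap j c = 0 := T4_hom_ext fun L₁ L₂ L₃ L₄ => by
    rw [LinearMap.comp_apply, coeffMap_Thm]
    split_ifs with h5
    · refine (Submodule.Quotient.mk_eq_zero M).2 (M.smul_mem _ (h.mem _ ?_))
      simp only [List.length_append]
      omega
    · simp
  simpa using LinearMap.congr_fun h0 x

lemma IsTarget.coeffMap_T4map {hg : 5 ≤ g} {M : Submodule ℚ A}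
    {ρ : (Hsp g ≃ₗ[ℚ] Hsp g) → A →ₐ[ℚ] A} (h : IsTarget hg M j ρ ε) (σ : Hsp g ≃ₗ[ℚ] Hsp g)
    (x : T4 g) : coeffMap j c (T4map g σ.toLinearMap x) = ρ σ (coeffMap j c x) := by
  have h0 : coeffMap j c ∘ₗ T4map g σ.toLinearMap = (ρ σ).toLinearMap ∘ₗ coeffMap j c :=
    T4_hom_ext fun L₁ L₂ L₃ L₄ => by
      rw [LinearMap.comp_apply, LinearMap.comp_apply, T4map_Thm, coeffMap_Thm, coeffMap_Thm]
      split_ifs <;> simp_all [h.map_jprod]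
  exact LinearMap.congr_fun h0 x

end Construction

/-! ### Equivariant maps and solutions of the linear system -/

lemma T4map_mem_T4deg {g m : ℕ} (φ : Hsp g →ₗ[ℚ] Hsp g) {x : T4 g} (hx : x ∈ T4deg g m) :
    T4map g φ x ∈ T4deg g m := by
  refine (Submodule.Quotient.mk_eq_zero _).1
    (eq_zero_of_mem_T4deg ((T4deg g m).mkQ ∘ₗ T4map g φ) (fun L₁ L₂ L₃ L₄ h => ?_) hx)
  rw [LinearMap.comp_apply, T4map_Thm]
  exact (Submodule.Quotient.mk_eq_zero _).2 (Thm_mem_T4deg (by simpa using h))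

lemma mk_mem_C12deg {g m : ℕ} {x y : T4 g} (hx : x ∈ T4deg g m) (hy : y ∈ T4deg g m) :
    (Submodule.Quotient.mk (x, y) : C12 g) ∈ C12deg g m :=
  Submodule.mem_map_of_mem (f := (Submodule.span ℚ (C12Rel g)).mkQ) ⟨hx, hy⟩

lemma mk_mem_Omega2deg {g m : ℕ} {x : T4 g} (hx : x ∈ T4deg g m) :
    (Submodule.Quotient.mk x : Omega2 g) ∈ Omega2deg g m :=
  Submodule.mem_map_of_mem (f := (Submodule.span ℚ (OmegaRel g)).mkQ) hx

section

variable {g : ℕ} {hg : 5 ≤ g} {A : Type*} [Ring A] [Algebra ℚ A]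
  {M : Submodule ℚ A} {j : Hsp g →ₗ[ℚ] A} {ρ : (Hsp g ≃ₗ[ℚ] Hsp g) → A →ₐ[ℚ] A}

/-- Equivariance of a linear map from `C₁₂^{(5)}`. -/
def IsEquivC12 (ρ : (Hsp g ≃ₗ[ℚ] Hsp g) → A →ₐ[ℚ] A) (π : C12deg g 5 →ₗ[ℚ] M) : Prop :=
  ∀ (σ : Hsp g ≃ₗ[ℚ] Hsp g) (p : P2 g) (hx : Submodule.Quotient.mk p ∈ C12deg g 5)
    (hy : Submodule.Quotient.mk (P2map g σ.toLinearMap p) ∈ C12deg g 5),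
    (π ⟨Submodule.Quotient.mk (P2map g σ.toLinearMap p), hy⟩ : A) =
      ρ σ (π ⟨Submodule.Quotient.mk p, hx⟩)

/-- Equivariance of a linear map from `Ω̃₂^{(5)}`. -/
def IsEquivOmega2 (ρ : (Hsp g ≃ₗ[ℚ] Hsp g) → A →ₐ[ℚ] A) (π : Omega2deg g 5 →ₗ[ℚ] M) : Prop :=
  ∀ (σ : Hsp g ≃ₗ[ℚ] Hsp g) (x : T4 g) (hx : Submodule.Quotient.mk x ∈ Omega2deg g 5)
    (hy : Submodule.Quotient.mk (T4map g σ.toLinearMap x) ∈ Omega2deg g 5),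
    (π ⟨Submodule.Quotient.mk (T4map g σ.toLinearMap x), hy⟩ : A) =
      ρ σ (π ⟨Submodule.Quotient.mk x, hx⟩)

set_option maxHeartbeats 400000 in
/-- An equivariant map from `C₁₂^{(5)}` is determined by its values on `Θ`, which are given by a
solution of the linear system. -/
lemma IsTarget.exists_isSol_of_isEquivC12 {ε : ℚ} (h : IsTarget hg M j ρ ε)
    {π : C12deg g 5 →ₗ[ℚ] M} (hπ : IsEquivC12 ρ π) : ∃ f c, HasCoeff j f c ∧ IsSol ε c ∧
      (∀ x (hx : x ∈ T4deg g 5), f x = π ⟨_, mk_mem_C12deg hx (zero_mem _)⟩) ∧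
      ((∀ x ∈ T4deg g 5, f x = 0) → π = 0) := by
  obtain ⟨P, hP⟩ := LinearMap.exists_extend π
  have hP' : ∀ x, P x.1 = π x := fun x => LinearMap.congr_fun hP x
  set F : P2 g →ₗ[ℚ] A := M.subtype ∘ₗ P ∘ₗ (Submodule.span ℚ (C12Rel g)).mkQ with hF
  have hrel : ∀ x ∈ C12Rel g, F x = 0 := fun x hx => by
    have h0 : (Submodule.span ℚ (C12Rel g)).mkQ x = 0 :=
      (Submodule.Quotient.mk_eq_zero _).2 (Submodule.subset_span hx)
    simp only [hF, LinearMap.comp_apply, h0, map_zero]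
  have hFπ : ∀ x y (hx : x ∈ T4deg g 5) (hy : y ∈ T4deg g 5),
      F (x, y) = π ⟨_, mk_mem_C12deg hx hy⟩ := fun x y hx hy => by
    rw [← hP']; rfl
  set f : T4 g →ₗ[ℚ] A := F ∘ₗ LinearMap.inl ℚ _ _ with hf
  have hfF : ∀ x, F (x, 0) = f x := fun _ => rfl
  have hTh : ∀ t u v w, F (ThP g t u v w) = f (Th g t u v w) := fun _ _ _ _ => rfl
  obtain ⟨c, hc⟩ := h.exists_hasCoeff f
    (fun x hx => by rw [← hfF, hFπ x 0 hx (zero_mem _)]; exact Subtype.coe_prop _)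
    (fun σ x hx => by
      rw [← hfF, ← hfF, hFπ x 0 hx (zero_mem _), ← hπ σ (x, 0) (mk_mem_C12deg hx (zero_mem _))
        (by simpa [P2map] using mk_mem_C12deg (T4map_mem_T4deg _ hx) (zero_mem _)),
        hFπ _ 0 (T4map_mem_T4deg _ hx) (zero_mem _)]
      simp [P2map])
  refine ⟨f, c, hc, h.isSol hc ?_ ?_ ?_, fun x hx => hFπ x 0 hx (zero_mem _), fun h0 => ?_⟩
  · intro t u v w
    have := hrel _ (Or.inl ⟨t, u, v, w, rfl⟩)
    rwa [map_sub, sub_eq_zero, hTh, hTh] at this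
  · intro t u v w
    have := hrel _ (Or.inr (Or.inl ⟨t, u, v, w, rfl⟩))
    rwa [map_sub, sub_eq_zero, hTh, hTh] at this
  · intro t u v w a
    have := hrel _ (Or.inr (Or.inr (Or.inr (Or.inr (Or.inl ⟨t, u, v, w, a, rfl⟩)))))
    rwa [map_add, map_sub, map_sub, hTh, hTh, hTh, hTh] at this
  · have hD : ∀ y ∈ T4deg g 5, F (0, y) = 0 := fun y hy =>
      eq_zero_of_mem_T4deg (F ∘ₗ LinearMap.inr ℚ _ _) (fun L₁ L₂ L₃ L₄ h5 => by
        have e := hrel _ (Or.inr (Or.inr (Or.inr (Or.inr (Or.inr (Or.inr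
          ⟨mono g L₁, mono g L₂, mono g L₃, mono g L₄, rfl⟩))))))
        rw [map_sub, map_sub, hTh, hTh, barT_mono, barT_mono, Th_smul₁, Th_smul₃, ← Thm, ← Thm,
          h0 _ (Thm_mem_T4deg h5), h0 _ (Submodule.smul_mem _ _ (Submodule.smul_mem _ _
            (Thm_mem_T4deg (by simp; omega)))), sub_zero, sub_zero] at e
        exact e) hy
    ext ⟨_, ⟨x, y⟩, ⟨hx, hy⟩, rfl⟩
    have : F (x, y) = 0 := by
      rw [show (x, y) = (x, 0) + (0, y) by simp, map_add, hfF, h0 x hx, hD y hy, add_zero]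
    rw [hFπ x y hx hy] at this
    exact this

/-- Every solution of the linear system gives an equivariant map from `C₁₂^{(5)}`. -/
lemma IsTarget.exists_isEquivC12_of_isSol {ε : ℚ} (h : IsTarget hg M j ρ ε) (hε : ε = 1 ∨ ε = -1)
    {c : ℕ → ℕ → ℕ → ℕ → ℚ} (hc : IsSol ε c) : ∃ π : C12deg g 5 →ₗ[ℚ] M, IsEquivC12 ρ π ∧
      ∀ x (hx : x ∈ T4deg g 5),
        (π ⟨_, mk_mem_C12deg hx (zero_mem _)⟩ : A) = coeffMap j c x := by
  have hd := hc.isSolD hε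
  set F : P2 g →ₗ[ℚ] A := (coeffMap j c).coprod (coeffMap j (solD ε c)) with hF
  have hTh : ∀ t u v w, F (ThP g t u v w) = coeffMap j c (Th g t u v w) := fun t u v w => by
    simp [hF, ThP]
  have hD : ∀ t u v w, F (DP g t u v w) = coeffMap j (solD ε c) (Th g t u v w) :=
    fun t u v w => by simp [hF, DP]
  have hrel : Submodule.span ℚ (C12Rel g) ≤ LinearMap.ker F := by
    rw [Submodule.span_le]
    rintro _ (⟨t, u, v, w, rfl⟩ | ⟨t, u, v, w, rfl⟩ | ⟨t, u, v, w, rfl⟩ | ⟨t, u, v, w, rfl⟩ |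
      ⟨t, u, v, w, a, rfl⟩ | ⟨t, u, v, w, a, rfl⟩ | ⟨t, u, v, w, rfl⟩) <;>
      simp only [SetLike.mem_coe, LinearMap.mem_ker, map_add, map_sub, hTh, hD]
    · exact coeffMap_flip h.comm hc.flip t u v w
    · exact coeffMap_turn h.comm hc.turn t u v w
    · exact coeffMap_cross h.comm hd.cross t u v w
    · exact coeffMap_turn h.comm hd.turn t u v w
    · exact coeffMap_hair h.comm hc.hair t u v w a
    · rw [← neg_zero, ← coeffMap_hair h.comm
        (fun i j k l h4 => by linear_combination -(hd.hair i j k l h4)) t u v w a]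
      abel
    · exact coeffMap_cc h.comm hd.cc t u v w
  have hmem : ∀ x, (Submodule.span ℚ (C12Rel g)).liftQ F hrel x ∈ M := fun x => by
    obtain ⟨p, rfl⟩ := Submodule.Quotient.mk_surjective _ x
    exact M.add_mem (h.coeffMap_mem _) (h.coeffMap_mem _)
  refine ⟨LinearMap.codRestrict M _ hmem ∘ₗ (C12deg g 5).subtype, fun σ p hx hy => ?_,
    fun x hx => ?_⟩
  · change F (P2map g σ.toLinearMap p) = ρ σ (F p)
    simp [hF, P2map, h.coeffMap_T4map]
  · change F (x, 0) = _
    simp [hF]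

end

/-- A space of linear maps has dimension `n` when its elements are uniquely determined by `n`
prescribed scalar values. -/
lemma finrank_eq_of_eval {V W : Type*} [AddCommGroup V] [Module ℚ V] [AddCommGroup W] [Module ℚ W]
    (E : Submodule ℚ (V →ₗ[ℚ] W)) (φ : W →ₗ[ℚ] ℚ) {n : ℕ} (x : Fin n → V)
    (hinj : ∀ π ∈ E, (∀ i, φ (π (x i)) = 0) → π = 0)
    (hsurj : ∀ y : Fin n → ℚ, ∃ π ∈ E, ∀ i, φ (π (x i)) = y i) : Module.finrank ℚ E = n := by
  let κ : E →ₗ[ℚ] Fin n → ℚ := LinearMap.pi fun i => φ ∘ₗ LinearMap.applyₗ (x i) ∘ₗ E.subtype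
  have hκ : Function.Bijective κ :=
    ⟨(injective_iff_map_eq_zero κ).2 fun π hπ => Subtype.ext (hinj _ π.2 (congrFun hπ)),
      fun y => let ⟨π, hπ, hy⟩ := hsurj y; ⟨⟨π, hπ⟩, funext hy⟩⟩
  rw [(LinearEquiv.ofBijective κ hκ).finrank_eq]
  simp

section

variable {g : ℕ} {hg : 5 ≤ g} {A : Type*} [Ring A] [Algebra ℚ A]
  {M : Submodule ℚ A} {j : Hsp g →ₗ[ℚ] A} {ρ : (Hsp g ≃ₗ[ℚ] Hsp g) → A →ₐ[ℚ] A}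

/-- Three quadruples of monomials on which the values of an equivariant map can be prescribed. -/
def pivot (hg : 5 ≤ g) : Fin 3 → T4 g :=
  ![Thm g ((List.ofFn (ev hg)).take 4) [] ((List.ofFn (ev hg)).drop 4) [],
    Thm g ((List.ofFn (ev hg)).take 4) ((List.ofFn (ev hg)).drop 4) [] [],
    Thm g (List.ofFn (ev hg)) [] [] []]

lemma pivot_mem_T4deg (hg : 5 ≤ g) (i : Fin 3) : pivot hg i ∈ T4deg g 5 := by
  fin_cases i <;> exact Thm_mem_T4deg (by simp)

lemma HasCoeff.apply_pivot {f : T4 g →ₗ[ℚ] A} {c : ℕ → ℕ → ℕ → ℕ → ℚ} (hc : HasCoeff j f c)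
    (i : Fin 3) : f (pivot hg i) =
      ![c 4 0 1 0, c 4 1 0 0, c 5 0 0 0] i • jprod j (List.ofFn (ev hg)) := by
  have h : (List.ofFn (ev hg)).take 4 ++ (List.ofFn (ev hg)).drop 4 = List.ofFn (ev hg) :=
    List.take_append_drop _ _
  fin_cases i
  · refine (hc _ _ _ _ (by simp)).trans ?_
    rw [List.nil_append, List.append_nil, h]
    simp
  · refine (hc _ _ _ _ (by simp)).trans ?_
    rw [List.append_nil, List.append_nil, h]
    simp
  · refine (hc _ _ _ _ (by simp)).trans ?_
    simp

set_option maxHeartbeats 1000000 in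
/-- The space of equivariant maps from `C₁₂^{(5)}` is three-dimensional. -/
lemma IsTarget.finrank_eq_three {ε : ℤ} (h : IsTarget hg M j ρ ε) (hε : ε = 1 ∨ ε = -1)
    (E : Submodule ℚ (C12deg g 5 →ₗ[ℚ] M)) (hE : ∀ π, π ∈ E ↔ IsEquivC12 ρ π) :
    Module.finrank ℚ E = 3 := by
  have hε' : (ε : ℚ) = 1 ∨ (ε : ℚ) = -1 := by exact_mod_cast hε
  obtain ⟨φ, hφ⟩ : ∃ φ : A →ₗ[ℚ] ℚ, φ (jprod j (List.ofFn (ev hg))) ≠ 0 := by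
    by_contra! h0
    exact h.ne_zero ((Module.forall_dual_apply_eq_zero_iff ℚ _).1 h0)
  refine finrank_eq_of_eval E (φ ∘ₗ M.subtype)
    (fun i : Fin 3 => ⟨_, mk_mem_C12deg (pivot_mem_T4deg hg i) (zero_mem _)⟩)
    (fun π hE' hπ => ?_) (fun y => ?_)
  · obtain ⟨f, c, hc, hs, hf, h0⟩ := h.exists_isSol_of_isEquivC12 ((hE _).1 hE')
    have hp : ∀ i, ![c 4 0 1 0, c 4 1 0 0, c 5 0 0 0] i = 0 := fun i => by
      have e : φ (π ⟨_, mk_mem_C12deg (pivot_mem_T4deg hg i) (zero_mem _)⟩) = 0 := hπ i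
      rw [← hf _ (pivot_mem_T4deg hg i), hc.apply_pivot, map_smul, smul_eq_mul] at e
      exact (mul_eq_zero.1 e).resolve_right hφ
    refine h0 fun x hx => eq_zero_of_mem_T4deg f (fun L₁ L₂ L₃ L₄ h5 => ?_) hx
    rw [hc _ _ _ _ h5, hs.eq_zero hε' (hp 0) (hp 1) (hp 2) _ _ _ _ h5, zero_smul]
  · set z : Fin 3 → ℚ := fun i => y i / φ (jprod j (List.ofFn (ev hg))) with hz
    obtain ⟨π, hπ, hf⟩ := h.exists_isEquivC12_of_isSol hε' (isSol_sol hε (z 0) (z 1) (z 2))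
    obtain ⟨h₀, h₁, h₂⟩ := sol_values hε (z 0) (z 1) (z 2)
    refine ⟨π, (hE _).2 hπ, fun i => ?_⟩
    rw [LinearMap.comp_apply, Submodule.subtype_apply, hf _ (pivot_mem_T4deg hg i),
      (hasCoeff_coeffMap j _).apply_pivot, h₀, h₁, h₂, map_smul, smul_eq_mul]
    fin_cases i <;> exact div_mul_cancel₀ _ hφ

/-- Equivariant maps from `Ω̃₂^{(5)}` vanish. -/
lemma IsTarget.eq_zero_of_isEquivOmega2 {ε : ℤ} (h : IsTarget hg M j ρ ε) (hε : ε = 1 ∨ ε = -1)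
    {π : Omega2deg g 5 →ₗ[ℚ] M} (hπ : IsEquivOmega2 ρ π) : π = 0 := by
  obtain ⟨P, hP⟩ := LinearMap.exists_extend π
  have hP' : ∀ x, P x.1 = π x := fun x => LinearMap.congr_fun hP x
  set f : T4 g →ₗ[ℚ] A := M.subtype ∘ₗ P ∘ₗ (Submodule.span ℚ (OmegaRel g)).mkQ with hf
  have hrel : ∀ x ∈ OmegaRel g, f x = 0 := fun x hx => by
    have h0 : (Submodule.span ℚ (OmegaRel g)).mkQ x = 0 :=
      (Submodule.Quotient.mk_eq_zero _).2 (Submodule.subset_span hx)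
    simp only [hf, LinearMap.comp_apply, h0, map_zero]
  have hfπ : ∀ x (hx : x ∈ T4deg g 5), f x = π ⟨_, mk_mem_Omega2deg hx⟩ := fun x hx => by
    rw [← hP']; rfl
  obtain ⟨c, hc⟩ := h.exists_hasCoeff f
    (fun x hx => by rw [hfπ x hx]; exact Subtype.coe_prop _)
    (fun σ x hx => by
      rw [hfπ x hx, hfπ _ (T4map_mem_T4deg _ hx), ← hπ σ x (mk_mem_Omega2deg hx)])
  have hs : IsSol ε c := by
    refine h.isSol hc (fun t u v w => ?_) (fun t u v w => ?_) (fun t u v w a => ?_)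
    · rw [← sub_eq_zero, ← map_sub]
      exact hrel _ (Or.inl ⟨t, u, v, w, rfl⟩)
    · rw [← sub_eq_zero, ← map_sub]
      exact hrel _ (Or.inr (Or.inl ⟨t, u, v, w, rfl⟩))
    · rw [← map_sub, ← map_sub, ← map_add]
      exact hrel _ (Or.inr (Or.inr (Or.inl ⟨t, u, v, w, a, rfl⟩)))
  have hgc : ∀ t u v w, f (gc3 g t u v w) = 0 := fun t u v w =>
    hrel _ (Or.inr (Or.inr (Or.inr ⟨t, u, v, w, rfl⟩)))
  have hne : jprod j [ev hg 0, ev hg 1, ev hg 2, ev hg 3, ev hg 4] ≠ 0 := by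
    simpa using h.ne_zero
  have h0 := hs.eq_zero_of_gc3 hε
    ((smul_eq_zero.1 ((hc.gc3_one_one_one_two h.comm _ _ _ _ _).symm.trans
      (hgc _ _ _ _))).resolve_right hne)
    ((smul_eq_zero.1 ((hc.gc3_zero_one_two_two h.comm _ _ _ _ _).symm.trans
      (hgc _ _ _ _))).resolve_right hne)
    ((smul_eq_zero.1 ((hc.gc3_zero_two_one_two h.comm _ _ _ _ _).symm.trans
      (hgc _ _ _ _))).resolve_right hne)
  ext ⟨_, x, hx, rfl⟩
  have e : f x = 0 := eq_zero_of_mem_T4deg f (fun L₁ L₂ L₃ L₄ h5 => by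
    rw [hc _ _ _ _ h5, h0 _ _ _ _ h5, zero_smul]) hx
  rw [hfπ x hx] at e
  exact e

end

section Exterior

open Module Set

lemma jprod_ι_ofFn (g : ℕ) {n : ℕ} (v : Fin n → Hsp g) :
    jprod (ExteriorAlgebra.ι ℚ) (List.ofFn v) = ExteriorAlgebra.ιMulti ℚ n v := by
  rw [jprod, List.map_ofFn, ExteriorAlgebra.ιMulti_apply]
  rfl

/-- The first five coordinates, as a finite set. -/
def firstFive {g : ℕ} (hg : 5 ≤ g) : powersetCard (Fin (2 * g)) 5 :=
  powersetCard.ofFinEmbEquiv (Fin.castLEOrderEmb (by omega))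

lemma ev_eq_basis {g : ℕ} (hg : 5 ≤ g) :
    exteriorPower.ιMulti_family ℚ 5 (Pi.basisFun ℚ (Fin (2 * g))) (firstFive hg) =
      exteriorPower.ιMulti ℚ 5 (ev hg) := by
  rw [exteriorPower.ιMulti_family, firstFive, Equiv.symm_apply_apply]
  congr 1
  ext i
  simp [ev]

lemma dil_basisFun (g : ℕ) (i k : Fin (2 * g)) : dil g i (Pi.basisFun ℚ _ k) =
    (if k = i then 2 else 1 : ℚ) • Pi.basisFun ℚ _ k := by
  ext l
  rw [dil_apply]
  by_cases h : k = l
  · subst h; split_ifs <;> simp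
  · split_ifs <;> simp [Pi.single_eq_of_ne' h]

lemma map_dil_ιMulti_family (g n : ℕ) (i : Fin (2 * g)) (s : powersetCard (Fin (2 * g)) n) :
    exteriorPower.map n (dil g i).toLinearMap
        (exteriorPower.ιMulti_family ℚ n (Pi.basisFun ℚ (Fin (2 * g))) s) =
      (if i ∈ s.1 then 2 else 1 : ℚ) •
        exteriorPower.ιMulti_family ℚ n (Pi.basisFun ℚ (Fin (2 * g))) s := by
  rw [exteriorPower.ιMulti_family, exteriorPower.map_apply_ιMulti]
  have e : (dil g i).toLinearMap ∘ (Pi.basisFun ℚ (Fin (2 * g)) ∘ powersetCard.ofFinEmbEquiv.symm s)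
      = fun k => (if powersetCard.ofFinEmbEquiv.symm s k = i then 2 else 1 : ℚ) •
        (Pi.basisFun ℚ (Fin (2 * g)) ∘ powersetCard.ofFinEmbEquiv.symm s) k := by
    ext1 k
    exact dil_basisFun g i _
  rw [e, AlternatingMap.map_smul_univ]
  congr 1
  by_cases hi : i ∈ s.1
  · obtain ⟨k, rfl⟩ := (powersetCard.mem_range_ofFinEmbEquiv_symm_iff_mem s i).2 hi
    simp [hi]
  · rw [if_neg hi]
    refine Finset.prod_eq_one fun k _ => if_neg fun hk => hi ?_
    exact (powersetCard.mem_range_ofFinEmbEquiv_symm_iff_mem s i).1 ⟨k, hk⟩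

lemma coe_exteriorPower_map {g n : ℕ} (f : Hsp g →ₗ[ℚ] Hsp g) (x : ⋀[ℚ]^n (Hsp g)) :
    (exteriorPower.map n f x : ExteriorAlgebra ℚ (Hsp g)) = ExteriorAlgebra.map f x := by
  have e : (⋀[ℚ]^n (Hsp g)).subtype ∘ₗ exteriorPower.map n f =
      (ExteriorAlgebra.map f).toLinearMap ∘ₗ (⋀[ℚ]^n (Hsp g)).subtype := by
    ext v
    simp [ExteriorAlgebra.map_apply_ιMulti]
  exact LinearMap.congr_fun e x

lemma repr_map_dil {g n : ℕ} (i : Fin (2 * g)) (s : powersetCard (Fin (2 * g)) n)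
    (x : ⋀[ℚ]^n (Hsp g)) :
    ((Pi.basisFun ℚ (Fin (2 * g))).exteriorPower n).repr
        (exteriorPower.map n (dil g i).toLinearMap x) s =
      (if i ∈ s.1 then 2 else 1 : ℚ) *
        ((Pi.basisFun ℚ (Fin (2 * g))).exteriorPower n).repr x s := by
  have e : ((Pi.basisFun ℚ (Fin (2 * g))).exteriorPower n).coord s ∘ₗ
        exteriorPower.map n (dil g i).toLinearMap =
      (if i ∈ s.1 then 2 else 1 : ℚ) •
        ((Pi.basisFun ℚ (Fin (2 * g))).exteriorPower n).coord s := by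
    refine ((Pi.basisFun ℚ (Fin (2 * g))).exteriorPower n).ext fun t => ?_
    rw [LinearMap.comp_apply, exteriorPower.basis_apply, map_dil_ιMulti_family, map_smul,
      LinearMap.smul_apply, ← exteriorPower.basis_apply, Basis.coord_apply, Basis.repr_self]
    by_cases h : t = s
    · rw [h]
    · rw [Finsupp.single_eq_of_ne' h, smul_zero, smul_zero]
  exact LinearMap.congr_fun e x

lemma isTarget_exterior {g : ℕ} (hg : 5 ≤ g) :
    IsTarget hg (⋀[ℚ]^5 (Hsp g)) (ExteriorAlgebra.ι ℚ)
      (fun σ => ExteriorAlgebra.map σ.toLinearMap) ((-1 : ℤ) : ℚ) where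
  comm a b := by
    have h := ExteriorAlgebra.ι_add_mul_swap (R := ℚ) a b
    rw [add_eq_zero_iff_eq_neg] at h
    simp [h]
  map_j σ a := by simp
  mem L hL := by
    rw [← hL, ← List.ofFn_get L, jprod_ι_ofFn, List.length_ofFn]
    exact (exteriorPower.ιMulti ℚ _ _).2
  ne_zero h := by
    rw [jprod_ι_ofFn] at h
    have h' : exteriorPower.ιMulti ℚ 5 (ev hg) = 0 := Subtype.ext h
    rw [← ev_eq_basis, ← exteriorPower.basis_apply] at h'
    exact Basis.ne_zero _ _ h'
  weight x hx h := by
    set b := (Pi.basisFun ℚ (Fin (2 * g))).exteriorPower 5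
    refine ⟨b.repr ⟨x, hx⟩ (firstFive hg), ?_⟩
    rw [jprod_ι_ofFn]
    suffices e : (⟨x, hx⟩ : ⋀[ℚ]^5 (Hsp g)) =
        b.repr ⟨x, hx⟩ (firstFive hg) • exteriorPower.ιMulti ℚ 5 (ev hg) from
      congrArg Subtype.val e
    refine b.ext_elem fun s => ?_
    rw [← ev_eq_basis, ← exteriorPower.basis_apply, map_smul, Basis.repr_self, Finsupp.smul_apply]
    by_cases hs : firstFive hg = s
    · simp [hs]
    · rw [Finsupp.single_eq_of_ne' hs, smul_zero]
      obtain ⟨k, hk, hks⟩ := (powersetCard.exists_mem_notMem_iff_ne _ _).1 hs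
      obtain ⟨i, rfl⟩ := (powersetCard.mem_ofFinEmbEquiv_iff_mem_range _ _).1 hk
      have e : exteriorPower.map 5 (dil g (Fin.castLE (by omega) i)).toLinearMap ⟨x, hx⟩ =
          (2 : ℚ) • (⟨x, hx⟩ : ⋀[ℚ]^5 (Hsp g)) :=
        Subtype.ext ((coe_exteriorPower_map _ _).trans (h i))
      have e' := repr_map_dil (Fin.castLE (by omega) i) s ⟨x, hx⟩
      rw [e, map_smul, Finsupp.smul_apply, if_neg (show Fin.castLE _ i ∉ s.1 from hks),
        smul_eq_mul] at e'
      linarith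

end Exterior

section Symmetric

open MvPolynomial

/-- The exponent vector of the product of the first five variables. -/
def fiveExp {g : ℕ} (hg : 5 ≤ g) : Fin (2 * g) →₀ ℕ :=
  ∑ i : Fin 5, Finsupp.single (Fin.castLE (by omega) i) 1

lemma degree_fiveExp {g : ℕ} (hg : 5 ≤ g) : (fiveExp hg).degree = 5 := by
  simp [fiveExp]

lemma fiveExp_le {g : ℕ} (hg : 5 ≤ g) {d : Fin (2 * g) →₀ ℕ}
    (hd : ∀ i : Fin 5, d (Fin.castLE (by omega) i) = 1) : fiveExp hg ≤ d := fun k => by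
  rw [fiveExp, Finsupp.finsetSum_apply]
  simp only [Finsupp.single_apply]
  by_cases hk : ∃ i : Fin 5, Fin.castLE (by omega) i = k
  · obtain ⟨i, rfl⟩ := hk
    simp [hd]
  · push Not at hk
    simp [hk]

lemma eq_fiveExp {g : ℕ} (hg : 5 ≤ g) {d : Fin (2 * g) →₀ ℕ} (h5 : d.degree = 5)
    (hd : ∀ i : Fin 5, d (Fin.castLE (by omega) i) = 1) : d = fiveExp hg := by
  have e := tsub_add_cancel_of_le (fiveExp_le hg hd)
  have e' := congrArg Finsupp.degree e
  rw [map_add, degree_fiveExp, h5, Nat.add_eq_right, Finsupp.degree_eq_zero_iff] at e'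
  rw [← e, e', zero_add]

/-- The linear form with given coefficients, as a polynomial. -/
def linForm (g : ℕ) : Hsp g →ₗ[ℚ] MvPolynomial (Fin (2 * g)) ℚ :=
  Fintype.linearCombination ℚ X

lemma linForm_apply (g : ℕ) (u : Hsp g) : linForm g u = ∑ i, u i • X i := rfl

lemma linForm_single (g : ℕ) (i : Fin (2 * g)) : linForm g (Pi.single i 1) = X i := by
  simp [linForm, Fintype.linearCombination_apply_single]

lemma polyAct_X (g : ℕ) (σ : Hsp g ≃ₗ[ℚ] Hsp g) (i : Fin (2 * g)) :
    polyAct g σ (X i) = linForm g (σ (Pi.single i 1)) := by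
  simp [polyAct, linForm_apply, smul_eq_C_mul]

lemma polyAct_linForm (g : ℕ) (σ : Hsp g ≃ₗ[ℚ] Hsp g) (u : Hsp g) :
    polyAct g σ (linForm g u) = linForm g (σ u) := by
  have e : (polyAct g σ).toLinearMap ∘ₗ linForm g = linForm g ∘ₗ σ.toLinearMap :=
    (Pi.basisFun ℚ _).ext fun i => by
      simp [linForm_single, polyAct_X]
  exact LinearMap.congr_fun e u

lemma coeff_polyAct_dil (g : ℕ) (i : Fin (2 * g)) (d : Fin (2 * g) →₀ ℕ)
    (x : MvPolynomial (Fin (2 * g)) ℚ) :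
    coeff d (polyAct g (dil g i) x) = 2 ^ d i * coeff d x := by
  have hX : ∀ k, polyAct g (dil g i) (X k) = (if k = i then 2 else 1 : ℚ) • X k := fun k => by
    rw [polyAct_X, ← Pi.basisFun_apply, dil_basisFun, map_smul, Pi.basisFun_apply, linForm_single]
  induction x using MvPolynomial.induction_on' with
  | monomial e a =>
    have h : polyAct g (dil g i) (monomial e a) = (2 : ℚ) ^ e i • monomial e a := by
      rw [monomial_eq, map_mul, Finsupp.prod, map_prod]
      simp only [map_pow, hX, smul_pow]
      rw [Finset.prod_smul, ← mul_smul_comm, Finset.prod_eq_single i]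
      · simp
      · intro k _ hk
        rw [if_neg hk, one_pow]
      · intro hi
        rw [Finsupp.notMem_support_iff.1 hi, pow_zero]
    rw [h, coeff_smul, smul_eq_mul, coeff_monomial]
    split_ifs with hd
    · rw [hd]
    · simp
  | add p q hp hq => rw [map_add, coeff_add, hp, hq, coeff_add, mul_add]

lemma jprod_linForm_ev {g : ℕ} (hg : 5 ≤ g) :
    jprod (linForm g) (List.ofFn (ev hg)) = monomial (fiveExp hg) 1 := by
  rw [jprod, List.map_ofFn, List.prod_ofFn, fiveExp, monomial_sum_one]
  exact Finset.prod_congr rfl fun i _ => linForm_single g _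

lemma isHomogeneous_jprod_linForm {g : ℕ} (L : List (Hsp g)) :
    (jprod (linForm g) L).IsHomogeneous L.length := by
  induction L with
  | nil => exact isHomogeneous_one _ _
  | cons u L ih =>
    rw [List.length_cons, add_comm]
    refine IsHomogeneous.mul (IsHomogeneous.sum _ _ _ fun i _ => ?_) ih
    exact (homogeneousSubmodule _ ℚ 1).smul_mem _ (isHomogeneous_X ℚ i)

lemma isTarget_symmetric {g : ℕ} (hg : 5 ≤ g) :
    IsTarget hg (homogeneousSubmodule (Fin (2 * g)) ℚ 5) (linForm g) (polyAct g) ((1 : ℤ) : ℚ) where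
  comm a b := by
    rw [Int.cast_one, one_smul]
    exact mul_comm _ _
  map_j σ a := polyAct_linForm g σ a
  mem L hL := hL ▸ isHomogeneous_jprod_linForm L
  ne_zero h := by
    rw [jprod_linForm_ev, monomial_eq_zero] at h
    exact one_ne_zero h
  weight x hx h := by
    refine ⟨coeff (fiveExp hg) x, ?_⟩
    rw [jprod_linForm_ev]
    ext d
    rw [coeff_smul, coeff_monomial, smul_eq_mul]
    split_ifs with hd
    · rw [hd, mul_one]
    rw [mul_zero]
    by_contra h0
    refine hd (eq_fiveExp hg ?_ fun i => ?_).symm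
    · rw [Finsupp.degree_eq_weight_one]
      exact hx h0
    · have e := congrArg (coeff d) (h i)
      rw [coeff_polyAct_dil, coeff_smul, smul_eq_mul] at e
      have e' := mul_right_cancel₀ h0 e
      exact Nat.pow_right_injective le_rfl (by exact_mod_cast e'.trans (pow_one 2).symm)

end Symmetric

/-- The multiplicities of `[1⁵]` and `[5]` in the `n = 7` row of Proposition 4.1:
stably, the space of `GL(H)`-equivariant maps `C₁₂^{(5)} → Λ⁵H` has dimension `3`,
the space of equivariant maps `C₁₂^{(5)} → Sym⁵H` has dimension `3`, and every
equivariant map `Ω̃₂^{(5)} → Λ⁵H` and every equivariant map `Ω̃₂^{(5)} → Sym⁵H`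
is zero. -/
theorem degree7_multiplicities :
    ∃ G : ℕ, 1 ≤ G ∧ ∀ g : ℕ, G ≤ g →
      Module.finrank ℚ ↥(equivC12toLam g 5 5) = 3 ∧
      Module.finrank ℚ ↥(equivC12toSym g 5 5) = 3 ∧
      equivOmega2toLam g 5 5 = ⊥ ∧
      equivOmega2toSym g 5 5 = ⊥ := by
  refine ⟨5, by norm_num, fun g hg => ⟨?_, ?_, ?_, ?_⟩⟩
  · exact (isTarget_exterior hg).finrank_eq_three (Or.inr rfl) _ fun _ => Iff.rfl
  · exact (isTarget_symmetric hg).finrank_eq_three (Or.inl rfl) _ fun _ => Iff.rfl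
  · exact (Submodule.eq_bot_iff _).2 fun _ hπ =>
      (isTarget_exterior hg).eq_zero_of_isEquivOmega2 (Or.inr rfl) hπ
  · exact (Submodule.eq_bot_iff _).2 fun _ hπ =>
      (isTarget_symmetric hg).eq_zero_of_isEquivOmega2 (Or.inl rfl) hπ
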